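/- The fundamental group π₁𝒰𝒲_n is isomorphic to the group with presentation having generators ρ_1,…,ρ_{n−1}, σ_1,…,σ_{n−1} and relations: ρ_iρ_j = ρ_jρ_i, σ_iσ_j = σ_jσ_i, ρ_iσ_j = σ_jρ_i whenever |i−j| ≥ 2; ρ_iρ_{i+1}ρ_i = ρ_{i+1}ρ_iρ_{i+1} and σ_iσ_{i+1}σ_i = σ_{i+1}σ_iσ_{i+1}; and ρ_iσ_{i+1}σ_i = σ_{i+1}σ_iρ_{i+1}, σ_iσ_{i+1}ρ_i = ρ_{i+1}σ_iσ_{i+1}, σ_iρ_{i+1}ρ_i = ρ_{i+1}ρ_iσ_{i+1}. -/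

import Mathlib

noncomputable section

open CategoryTheory

abbrev E2 : Type := EuclideanSpace ℝ (Fin 2)
abbrev E3 : Type := EuclideanSpace ℝ (Fin 3)

/-- The point of `ℝ³` with the given coordinates. -/
def e3mk (x y z : ℝ) : E3 := (WithLp.equiv 2 (Fin 3 → ℝ)).symm ![x, y, z]

/-- The wicket with endpoints `a, b ∈ ℝ²`: the semicircle in upper half-space lying in
the vertical plane through `(a,0)` and `(b,0)`, with center `m = ((a+b)/2, 0)` and
radius `‖a-b‖/2`. -/
def wicket (a b : E2) : Set E3 :=
  {x | 0 ≤ x 2 ∧ dist x (e3mk ((a 0 + b 0) / 2) ((a 1 + b 1) / 2) 0) = dist a b / 2 ∧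
    ∃ t : ℝ, x 0 = a 0 + t * (b 0 - a 0) ∧ x 1 = a 1 + t * (b 1 - a 1)}

/-- An `n`-tuple of endpoint pairs of pairwise disjoint wickets. -/
def IsWicketTuple {n : ℕ} (f : Fin n → E2 × E2) : Prop :=
  (∀ i, (f i).1 ≠ (f i).2) ∧
  (∀ i j, i ≠ j → Disjoint (wicket (f i).1 (f i).2) (wicket (f j).1 (f j).2))

/-- The space of ordered `n`-tuples of pairwise disjoint wickets. -/
abbrev WicketTuple (n : ℕ) : Type := {f : Fin n → E2 × E2 // IsWicketTuple f}

/-- Two tuples are identified iff they determine the same `n`-element set of wickets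
(this permutes the wickets and swaps endpoints). -/
def wicketSetoid (n : ℕ) : Setoid (WicketTuple n) where
  r f g := (Set.range fun i => wicket (f.1 i).1 (f.1 i).2) =
    Set.range fun i => wicket (g.1 i).1 (g.1 i).2
  iseqv := ⟨fun _ => rfl, Eq.symm, Eq.trans⟩

/-- The wicket space `𝒲_n`: configurations of `n` disjoint wickets, with the quotient
topology. -/
abbrev WConf (n : ℕ) : Type := Quotient (wicketSetoid n)

/-- All wickets of the tuple lie in planes perpendicular to the `x`-axis: both endpoints
of each wicket have the same `x`-coordinate. -/
def IsUWTuple {n : ℕ} (f : WicketTuple n) : Prop := ∀ i, (f.1 i).1 0 = (f.1 i).2 0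

/-- The untwisted wicket space `𝒰𝒲_n ⊆ 𝒲_n`. -/
def UWConf (n : ℕ) : Set (WConf n) :=
  {x | ∃ f, Quotient.mk (wicketSetoid n) f = x ∧ IsUWTuple f}

/-- Generators `ρ_0, …, ρ_{n-2}` and `σ_0, …, σ_{n-2}` (indexed from 0). -/
abbrev BrGen (n : ℕ) : Type := Fin (n - 1) ⊕ Fin (n - 1)

/-- The generator `ρ_i`. -/
def gρ {n : ℕ} (i : Fin (n - 1)) : FreeGroup (BrGen n) := FreeGroup.of (Sum.inl i)

/-- The generator `σ_i`. -/
def gσ {n : ℕ} (i : Fin (n - 1)) : FreeGroup (BrGen n) := FreeGroup.of (Sum.inr i)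

/-- The relations `ρ_iρ_j = ρ_jρ_i`, `σ_iσ_j = σ_jσ_i`, `ρ_iσ_j = σ_jρ_i` for
`|i-j| ≥ 2`; `ρ_iρ_{i+1}ρ_i = ρ_{i+1}ρ_iρ_{i+1}`, `σ_iσ_{i+1}σ_i = σ_{i+1}σ_iσ_{i+1}`;
`ρ_iσ_{i+1}σ_i = σ_{i+1}σ_iρ_{i+1}`, `σ_iσ_{i+1}ρ_i = ρ_{i+1}σ_iσ_{i+1}`,
`σ_iρ_{i+1}ρ_i = ρ_{i+1}ρ_iσ_{i+1}`, written as relators. -/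
def uwRels (n : ℕ) : Set (FreeGroup (BrGen n)) :=
  (⋃ (i : Fin (n - 1)) (j : Fin (n - 1)) (_ : (i : ℕ) + 2 ≤ (j : ℕ) ∨ (j : ℕ) + 2 ≤ (i : ℕ)),
    {gρ i * gρ j * (gρ j * gρ i)⁻¹, gσ i * gσ j * (gσ j * gσ i)⁻¹,
      gρ i * gσ j * (gσ j * gρ i)⁻¹}) ∪
  (⋃ (i : Fin (n - 1)) (j : Fin (n - 1)) (_ : (j : ℕ) = (i : ℕ) + 1),
    {gρ i * gρ j * gρ i * (gρ j * gρ i * gρ j)⁻¹,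
      gσ i * gσ j * gσ i * (gσ j * gσ i * gσ j)⁻¹,
      gρ i * gσ j * gσ i * (gσ j * gσ i * gρ j)⁻¹,
      gσ i * gσ j * gρ i * (gρ j * gσ i * gσ j)⁻¹,
      gσ i * gρ j * gρ i * (gρ j * gρ i * gσ j)⁻¹})


section
open Topology Filter

section TheoremA
variable {X G : Type*} [TopologicalSpace X] [Group G] [TopologicalSpace G] [DiscreteTopology G]

def hcore (N : X → Set X) (hN : ∀ x, IsOpen (N x)) (hx : ∀ x, x ∈ N x) (c : X → X → G)
    (hc : ∀ x, ∀ y ∈ N x, ∀ᶠ z in 𝓝 y, c x z = c x y * c y z) : FiberBundleCore X X G where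
  baseSet := N
  isOpen_baseSet := hN
  indexAt := id
  mem_baseSet_at := hx
  coordChange i j z g := g * c i z * (c j z)⁻¹
  coordChange_self := by intro i x hx v; simp
  continuousOn_coordChange := by
    intro i j
    rintro ⟨z0, g0⟩ ⟨⟨hi, hj⟩, -⟩
    apply ContinuousAt.continuousWithinAt
    have h : (fun p : X × G => p.2 * c i p.1 * (c j p.1)⁻¹) =ᶠ[𝓝 (z0, g0)]
        fun p => p.2 * c i z0 * (c j z0)⁻¹ := by
      have h1 : ∀ᶠ z in 𝓝 z0, c i z = c i z0 * c z0 z ∧ c j z = c j z0 * c z0 z :=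
        (hc i z0 hi).and (hc j z0 hj)
      filter_upwards [continuous_fst.continuousAt.eventually h1] with p hp
      rw [hp.1, hp.2]; group
    refine ContinuousAt.congr ?_ h.symm
    have : Continuous (fun p : X × G => p.2 * c i z0 * (c j z0)⁻¹) :=
      (continuous_of_discreteTopology (f := fun g : G => g * c i z0 * (c j z0)⁻¹)).comp
        continuous_snd
    exact this.continuousAt
  coordChange_comp := by intro i j k x hx v; group

theorem cov_monodromy_eq {E X : Type*} [TopologicalSpace E] [TopologicalSpace X] {p : E → X}
    (cov : IsCoveringMap p) {x y : X} (γ : Path x y) (Γ : unitInterval → E) (hΓ : Continuous Γ)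
    (hl : p ∘ Γ = γ) (e : p ⁻¹' {x}) (h0 : Γ 0 = e.1) :
    (cov.monodromy (Path.Homotopic.Quotient.mk γ) e).1 = Γ 1 := by
  have := (cov.eq_liftPath_iff (γ := γ.toContinuousMap) (e := e.1)
    (γ_0 := γ.source.trans e.2.symm) (Γ := Γ)).2 ⟨hΓ, hl, h0⟩
  rw [this]; rfl

theorem exists_holonomy_aux (N : X → Set X) (hN : ∀ x, IsOpen (N x)) (hx : ∀ x, x ∈ N x)
    (c : X → X → G)
    (hc : ∀ x, ∀ y ∈ N x, ∀ᶠ z in 𝓝 y, c x z = c x y * c y z) :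
    ∃ Φ : ∀ {x y : X}, Path.Homotopic.Quotient x y → G,
      (∀ {x y z : X} (γ : Path.Homotopic.Quotient x y) (γ' : Path.Homotopic.Quotient y z),
        Φ (γ.trans γ') = Φ γ * Φ γ') ∧
      ∀ (x : X) {a b : X} (γ : Path a b), (∀ t, γ t ∈ N x) →
        Φ (Path.Homotopic.Quotient.mk γ) = (c x a)⁻¹ * c x b := by
  let Z := hcore N hN hx c hc
  have cov : IsCoveringMap (Bundle.TotalSpace.proj : Bundle.TotalSpace G Z.Fiber → X) :=
    FiberBundle.isCoveringMap
  have hone : ∀ x, c x x = 1 := fun x => by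
    have := (hc x x (hx x)).self_of_nhds
    simpa using this
  have hcoord : ∀ (x0 : X) (e : Bundle.TotalSpace G Z.Fiber),
      ((trivializationAt G Z.Fiber x0) e).2 = @id G e.2 * (c x0 e.1)⁻¹ := by
    intro x0 e
    have : ((trivializationAt G Z.Fiber x0) e).2 = @id G e.2 * c e.1 e.1 * (c x0 e.1)⁻¹ := rfl
    rw [this, hone, mul_one]
  let L : G → Bundle.TotalSpace G Z.Fiber → Bundle.TotalSpace G Z.Fiber :=
    fun g e => ⟨e.1, g * @id G e.2⟩
  have hL : ∀ g, Continuous (L g) := by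
    intro g
    rw [continuous_iff_continuousAt]
    intro e
    rw [FiberBundle.continuousAt_totalSpace]
    refine ⟨cov.continuous.continuousAt, ?_⟩
    have h2 := ((FiberBundle.continuousAt_totalSpace G (E := Z.Fiber) id (x₀ := e)).1
      continuousAt_id).2
    have h3 : (fun x => ((trivializationAt G Z.Fiber (L g e).proj) (L g x)).2) =
      (fun h : G => g * h) ∘ (fun x => ((trivializationAt G Z.Fiber (id e).proj) (id x)).2) := by
      funext x
      simp only [Function.comp]
      rw [hcoord, hcoord]
      exact mul_assoc _ _ _
    rw [h3]
    exact (continuous_of_discreteTopology (f := fun h : G => g * h)).continuousAt.comp h2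
  let Φ : ∀ {x y : X}, Path.Homotopic.Quotient x y → G := fun {x y} γ =>
    (cov.monodromy γ ⟨⟨x, (1 : G)⟩, rfl⟩).1.2
  have key : ∀ {x y : X} (γ : Path.Homotopic.Quotient x y) (g : G),
      (cov.monodromy γ ⟨⟨x, g⟩, rfl⟩).1 = ⟨y, (g * Φ γ : G)⟩ := by
    intro x y γ g
    obtain ⟨γ, rfl⟩ := Path.Homotopic.Quotient.mk_surjective γ
    obtain ⟨Γ, hΓ, hΓ0⟩ := cov.exists_path_lifts γ.toContinuousMap ⟨x, (1 : G)⟩ γ.source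
    have h1 := cov_monodromy_eq cov γ Γ Γ.continuous hΓ ⟨⟨x, (1 : G)⟩, rfl⟩ hΓ0
    have h2 := cov_monodromy_eq cov γ (L g ∘ Γ) ((hL g).comp Γ.continuous)
      (by rw [← Function.comp_assoc]; exact hΓ) ⟨⟨x, g⟩, rfl⟩ (by
        simp only [Function.comp, hΓ0, L]
        congr 1
        exact mul_one g)
    rw [h2]
    have h4 : (Γ 1).1 = y := by
      have := congrFun hΓ 1
      exact this.trans γ.target
    have h5 : Φ (Path.Homotopic.Quotient.mk γ) = @id G (Γ 1).2 :=
      congrArg (fun e : Bundle.TotalSpace G Z.Fiber => @id G e.2) h1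
    rw [h5]
    simp only [Function.comp, L]
    rw [h4]
  refine ⟨Φ, ?_, ?_⟩
  · intro x y z γ γ'
    have h1 := cov.monodromy_trans_apply γ γ' ⟨⟨x, (1 : G)⟩, rfl⟩
    have h2 : cov.monodromy γ ⟨⟨x, (1 : G)⟩, rfl⟩ = ⟨⟨y, Φ γ⟩, rfl⟩ := by
      apply Subtype.ext
      rw [key]; simp
    rw [h2] at h1
    have h3 := congrArg (fun e => (show G from e.1.2)) h1
    simp only at h3
    refine h3.trans ?_
    have := key γ' (Φ γ)
    rw [this]
  · intro x a b γ hγ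
    let Γ : unitInterval → Bundle.TotalSpace G Z.Fiber := fun t =>
      ⟨γ t, ((c x a)⁻¹ * c x (γ t) : G)⟩
    have hΓ : Continuous Γ := by
      rw [continuous_iff_continuousAt]
      intro t
      rw [FiberBundle.continuousAt_totalSpace]
      refine ⟨γ.continuous.continuousAt, ?_⟩
      refine ContinuousAt.congr (f := fun _ => (c x a)⁻¹ * c x (γ t)) continuousAt_const ?_
      have := γ.continuous.continuousAt.eventually (hc x (γ t) (hγ t))
      filter_upwards [this] with s hs
      rw [hcoord]
      simp only [Γ, id]
      rw [hs]; group
    have h1 := cov_monodromy_eq cov γ Γ hΓ rfl ⟨⟨a, (1 : G)⟩, rfl⟩ (by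
      simp only [Γ]
      rw [γ.source]
      congr 1
      exact inv_mul_cancel (c x a))
    simp only [Φ]
    rw [h1]
    simp only [Γ]
    rw [γ.target]
end TheoremA

theorem exists_holonomy {X G : Type*} [TopologicalSpace X] [Group G]
    (N : X → Set X) (hN : ∀ x, IsOpen (N x)) (hx : ∀ x, x ∈ N x)
    (c : X → X → G)
    (hc : ∀ x, ∀ y ∈ N x, ∀ᶠ z in 𝓝 y, c x z = c x y * c y z) :
    ∃ Φ : ∀ {x y : X}, Path.Homotopic.Quotient x y → G,
      (∀ {x y z : X} (γ : Path.Homotopic.Quotient x y) (γ' : Path.Homotopic.Quotient y z),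
        Φ (γ.trans γ') = Φ γ * Φ γ') ∧
      ∀ (x : X) {a b : X} (γ : Path a b), (∀ t, γ t ∈ N x) →
        Φ (Path.Homotopic.Quotient.mk γ) = (c x a)⁻¹ * c x b := by
  let _ : TopologicalSpace G := ⊥
  have _ : DiscreteTopology G := ⟨rfl⟩
  exact exists_holonomy_aux N hN hx c hc

end

section
section Cost
variable {α β G : Type*} [LinearOrder β] [Group G] (key : α → β) (g : ℕ → α → α → G)

def oins (a : α) : List α → List α
  | [] => [a]
  | b :: s => if key a ≤ key b then a :: b :: s else b :: oins a s

def isrt : List α → List α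
  | [] => []
  | a :: l => oins key a (isrt l)

def insc (k : ℕ) (a : α) : List α → G
  | [] => 1
  | b :: s => if key a ≤ key b then 1 else insc (k + 1) a s * g k b a

def cost (k : ℕ) : List α → G
  | [] => 1
  | a :: l => insc key g k a (isrt key l) * cost (k + 1) l

theorem mem_oins {a x : α} {s : List α} : x ∈ oins key a s ↔ x = a ∨ x ∈ s := by
  induction s with
  | nil => simp [oins]
  | cons b s ih =>
    unfold oins
    split_ifs
    · simp
    · simp [ih]; tauto

theorem mem_isrt {x : α} {l : List α} : x ∈ isrt key l ↔ x ∈ l := by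
  induction l with
  | nil => simp [isrt]
  | cons b s ih => simp [isrt, mem_oins, ih]

theorem length_oins {a : α} {s : List α} : (oins key a s).length = s.length + 1 := by
  induction s with
  | nil => simp [oins]
  | cons b s ih =>
    unfold oins
    split_ifs
    · simp
    · simp [ih]

theorem length_isrt {l : List α} : (isrt key l).length = l.length := by
  induction l with
  | nil => simp [isrt]
  | cons b s ih => simp [isrt, length_oins, ih]

theorem oins_comm {a b : α} (h : key b < key a) (s : List α) :
    oins key a (oins key b s) = oins key b (oins key a s) := by
  induction s with
  | nil => simp [oins, h.le, not_le.2 h]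
  | cons c s ih =>
    by_cases hb : key b ≤ key c
    · by_cases ha : key a ≤ key c
      · simp [oins, hb, ha, h.le, not_le.2 h]
      · simp [oins, hb, ha, not_le.2 h]
    · have ha : ¬ key a ≤ key c := fun h' => hb (h.le.trans h')
      simp [oins, hb, ha, ih]

theorem isrt_swap {a b : α} (h : key b < key a) (l1 l2 : List α) :
    isrt key (l1 ++ a :: b :: l2) = isrt key (l1 ++ b :: a :: l2) := by
  induction l1 with
  | nil => simp [isrt, oins_comm key h]
  | cons c l ih => simp [isrt, ih]

variable {key g} in
theorem insc_comm (hfar : ∀ k l a b c d, k + 2 ≤ l → Commute (g k a b) (g l c d))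
    (k l : ℕ) (h : k + 2 ≤ l) (a b c : α) (s : List α) :
    Commute (g k a b) (insc key g l c s) := by
  induction s generalizing l with
  | nil => exact Commute.one_right _
  | cons d s ih =>
    unfold insc
    split_ifs
    · exact Commute.one_right _
    · exact (ih (l + 1) (by omega)).mul_right (hfar _ _ _ _ _ _ h)

variable {key g} in
theorem cost_comm (hfar : ∀ k l a b c d, k + 2 ≤ l → Commute (g k a b) (g l c d))
    (k l : ℕ) (h : k + 2 ≤ l) (a b : α) (s : List α) :
    Commute (g k a b) (cost key g l s) := by
  induction s generalizing l with
  | nil => exact Commute.one_right _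
  | cons d s ih =>
    exact (insc_comm hfar _ _ h _ _ _ _).mul_right (ih _ (by omega))

variable {key g} in
theorem insc_swap {n : ℕ} {good : α → α → Prop}
    (hfar : ∀ k l a b c d, k + 2 ≤ l → Commute (g k a b) (g l c d))
    (hbr : ∀ k a b c, k + 2 < n → key a < key b → key b < key c → good a b → good a c → good b c →
      g k a b * g (k + 1) a c * g k b c = g (k + 1) b c * g k a c * g (k + 1) a b)
    {a b : α} (hab : key b < key a) (hg : good b a) (s : List α)
    (hs : ∀ c ∈ s, key c < key b → good c b ∧ good c a) (k : ℕ) (hk : k + s.length + 2 ≤ n) :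
    insc key g k a (oins key b s) * insc key g (k + 1) b s =
      insc key g k b (oins key a s) * insc key g (k + 1) a s * g k b a := by
  induction s generalizing k with
  | nil => simp [oins, insc, hab.le, not_le.2 hab]
  | cons c s ih =>
    by_cases hb : key b ≤ key c
    · by_cases ha : key a ≤ key c
      · simp [oins, insc, hb, ha, hab.le, not_le.2 hab]
      · simp [oins, insc, hb, ha, not_le.2 hab]
    · have hcb : key c < key b := not_le.1 hb
      have hca := hcb.trans hab
      have ha : ¬ key a ≤ key c := not_le.2 hca
      obtain ⟨g1, g2⟩ := hs c (by simp) hcb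
      simp only [List.length_cons] at hk
      have ih' := ih (fun c hc => hs c (by simp [hc])) (k + 1) (by omega)
      simp only [oins, insc, hb, ha, if_false]
      have e1 := (insc_comm (key := key) hfar k (k + 1 + 1) (by omega) c a b s).eq
      have e2 := (insc_comm (key := key) hfar k (k + 1 + 1) (by omega) c b a s).eq
      have e3 := hbr k c b a (by omega) hcb hab g1 g2 hg
      calc insc key g (k + 1) a (oins key b s) * g k c a *
            (insc key g (k + 1 + 1) b s * g (k + 1) c b)
          = insc key g (k + 1) a (oins key b s) * (g k c a *
            insc key g (k + 1 + 1) b s) * g (k + 1) c b := by group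
        _ = (insc key g (k + 1) a (oins key b s) * insc key g (k + 1 + 1) b s) *
              (g k c a * g (k + 1) c b) := by rw [e1]; group
        _ = insc key g (k + 1) b (oins key a s) * insc key g (k + 1 + 1) a s *
              (g (k + 1) b a * g k c a * g (k + 1) c b) := by rw [ih']; group
        _ = insc key g (k + 1) b (oins key a s) * (insc key g (k + 1 + 1) a s * g k c b) *
              (g (k + 1) c a * g k b a) := by rw [← e3]; group
        _ = _ := by rw [← e2]; group

variable {key g} in
theorem cost_swap {n : ℕ} {good : α → α → Prop}
    (hfar : ∀ k l a b c d, k + 2 ≤ l → Commute (g k a b) (g l c d))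
    (hbr : ∀ k a b c, k + 2 < n → key a < key b → key b < key c → good a b → good a c → good b c →
      g k a b * g (k + 1) a c * g k b c = g (k + 1) b c * g k a c * g (k + 1) a b)
    {a b : α} (hab : key b < key a) (l1 l2 : List α)
    (hs : (l1 ++ a :: b :: l2).Pairwise (fun p q => key q < key p → good q p))
    (k : ℕ) (hk : k + (l1 ++ a :: b :: l2).length ≤ n) :
    cost key g k (l1 ++ a :: b :: l2) = cost key g k (l1 ++ b :: a :: l2) *
      g (k + l1.length) b a := by
  induction l1 generalizing k with
  | nil =>
    simp only [List.nil_append, List.pairwise_cons, List.mem_cons] at hs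
    obtain ⟨h1, h2, -⟩ := hs
    have := insc_swap (n := n) hfar hbr hab (h1 b (Or.inl rfl) hab) (isrt key l2)
      (fun c hc hcb => by
        rw [mem_isrt] at hc
        exact ⟨h2 c hc hcb, h1 c (Or.inr hc) (hcb.trans hab)⟩) k (by
          rw [length_isrt]
          simp at hk
          omega)
    simp only [List.nil_append, cost, isrt, List.length_nil, Nat.add_zero]
    rw [← mul_assoc, this, mul_assoc, (cost_comm (key := key) hfar k (k + 1 + 1) (by omega) b a l2).eq]
    group
  | cons c l ih =>
    simp only [List.cons_append, List.pairwise_cons] at hs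
    simp only [List.cons_append, List.length_cons] at hk
    simp only [List.cons_append, cost]
    rw [ih hs.2 (k + 1) (by omega), isrt_swap key hab, ← mul_assoc, List.length_cons]
    congr 2
    omega

theorem isrt_sorted {l : List α} (h : l.Pairwise (fun a b => key a ≤ key b)) : isrt key l = l := by
  induction l with
  | nil => rfl
  | cons a l ih =>
    rw [List.pairwise_cons] at h
    simp only [isrt, ih h.2]
    cases l with
    | nil => rfl
    | cons b l => simp [oins, h.1 b (by simp)]

theorem cost_sorted {l : List α} (h : l.Pairwise (fun a b => key a ≤ key b)) (k : ℕ) :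
    cost key g k l = 1 := by
  induction l generalizing k with
  | nil => rfl
  | cons a l ih =>
    rw [List.pairwise_cons] at h
    simp only [cost, ih h.2, isrt_sorted key h.2]
    cases l with
    | nil => simp [insc]
    | cons b l => simp [insc, h.1 b (by simp)]

/-- function version -/
def costF {n : ℕ} (f : Fin n → α) : G := cost key g 0 (List.ofFn f)

theorem ofFn_split {n : ℕ} (f : Fin n → α) (k : ℕ) (hk : k + 1 < n) :
    ∃ l1 l2 : List α, l1.length = k ∧
      List.ofFn f = l1 ++ f ⟨k, by omega⟩ :: f ⟨k + 1, hk⟩ :: l2 ∧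
      List.ofFn (f ∘ Equiv.swap ⟨k, by omega⟩ ⟨k + 1, hk⟩) =
        l1 ++ f ⟨k + 1, hk⟩ :: f ⟨k, by omega⟩ :: l2 := by
  refine ⟨(List.ofFn f).take k, (List.ofFn f).drop (k + 2), by simp; omega, ?_, ?_⟩
  · apply List.ext_getElem
    · simp; omega
    · intro i h1 h2
      rw [List.getElem_append]
      simp only [List.length_ofFn] at h1
      split_ifs with h
      · simp
      · simp at h
        have hki : k ≤ i := by omega
        obtain ⟨j, rfl⟩ := Nat.exists_eq_add_of_le hki
        simp only [List.length_take, List.length_ofFn, Nat.min_eq_left (show k ≤ n by omega),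
          Nat.add_sub_cancel_left]
        match j with
        | 0 => simp
        | 1 => simp
        | j + 2 => simp; congr 2; omega
  · apply List.ext_getElem
    · simp; omega
    · intro i h1 h2
      rw [List.getElem_append]
      simp only [List.length_ofFn] at h1
      split_ifs with h
      · simp at h
        simp
        rw [Equiv.swap_apply_of_ne_of_ne] <;> simp [Fin.ext_iff] <;> omega
      · simp at h
        have hki : k ≤ i := by omega
        obtain ⟨j, rfl⟩ := Nat.exists_eq_add_of_le hki
        simp only [List.length_take, List.length_ofFn, Nat.min_eq_left (show k ≤ n by omega),
          Nat.add_sub_cancel_left]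
        match j with
        | 0 => simp
        | 1 => simp
        | j + 2 =>
          simp
          rw [Equiv.swap_apply_of_ne_of_ne]
          · congr 2; omega
          · simp [Fin.ext_iff]
          · simp [Fin.ext_iff]

variable {key g} in
theorem costF_swap {n : ℕ} {good : α → α → Prop}
    (hfar : ∀ k l a b c d, k + 2 ≤ l → Commute (g k a b) (g l c d))
    (hbr : ∀ k a b c, k + 2 < n → key a < key b → key b < key c → good a b → good a c → good b c →
      g k a b * g (k + 1) a c * g k b c = g (k + 1) b c * g k a c * g (k + 1) a b)
    (f : Fin n → α) (k : ℕ) (hk : k + 1 < n)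
    (hab : key (f ⟨k + 1, hk⟩) < key (f ⟨k, by omega⟩))
    (hs : ∀ i j, i < j → key (f j) < key (f i) → good (f j) (f i)) :
    costF key g f = costF key g (f ∘ Equiv.swap ⟨k, by omega⟩ ⟨k + 1, hk⟩) *
      g k (f ⟨k + 1, hk⟩) (f ⟨k, by omega⟩) := by
  obtain ⟨l1, l2, hl, h1, h2⟩ := ofFn_split f k hk
  have hs' : (List.ofFn f).Pairwise (fun p q => key q < key p → good q p) := by
    rw [List.pairwise_ofFn]
    exact fun i j hij => hs i j hij
  have hlen : (List.ofFn f).length = n := List.length_ofFn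
  unfold costF
  rw [h2]
  rw [h1] at hs' hlen ⊢
  rw [cost_swap (n := n) hfar hbr hab l1 l2 hs' 0 (by omega)]
  congr 2
  omega

theorem costF_sorted {n : ℕ} (f : Fin n → α) (h : ∀ i j, i < j → key (f i) ≤ key (f j)) :
    costF key g f = 1 := by
  apply cost_sorted
  rw [List.pairwise_ofFn]
  exact h

end Cost

theorem perm_desc_induction {n : ℕ} {β : Type*} [LinearOrder β] (v : Fin n → β)
    (R P : Equiv.Perm (Fin n) → Prop)
    (h0 : ∀ π, R π → StrictMono (v ∘ π) → P π)
    (hv : Function.Injective v)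
    (hs : ∀ π (k : ℕ) (hk : k + 1 < n), R π → v (π ⟨k + 1, hk⟩) < v (π ⟨k, by omega⟩) →
      R (π * Equiv.swap ⟨k, by omega⟩ ⟨k + 1, hk⟩) ∧
      (P (π * Equiv.swap ⟨k, by omega⟩ ⟨k + 1, hk⟩) → P π)) :
    ∀ π, R π → P π := by
  let rk : Fin n → ℕ := fun i => (Finset.univ.filter (fun j => v j < v i)).card
  have hrk : ∀ i j, v i < v j → rk i < rk j := by
    intro i j hij
    apply Finset.card_lt_card
    rw [Finset.ssubset_iff_of_subset]
    · exact ⟨i, by simpa using hij, by simp⟩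
    · intro l hl
      simp at hl ⊢
      exact hl.trans hij
  have hrb : ∀ i, rk i ≤ n := fun i => (Finset.card_le_univ _).trans (by simp)
  let m : Equiv.Perm (Fin n) → ℕ := fun π => ∑ k : Fin n, (k : ℕ) * rk (π k)
  have hmb : ∀ π, m π ≤ n * (n * n) := by
    intro π
    calc m π ≤ ∑ k : Fin n, n * n := by
          apply Finset.sum_le_sum
          intro k _
          exact Nat.mul_le_mul k.2.le (hrb _)
      _ = _ := by simp
  have hdesc : ∀ π : Equiv.Perm (Fin n), ¬ StrictMono (v ∘ π) →
      ∃ (k : ℕ) (hk : k + 1 < n), v (π ⟨k + 1, hk⟩) < v (π ⟨k, by omega⟩) := by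
    intro π hcon
    by_contra hno
    push Not at hno
    apply hcon
    have hall : ∀ d : ℕ, ∀ k : ℕ, ∀ h : k + d + 1 < n,
        v (π ⟨k, by omega⟩) < v (π ⟨k + d + 1, h⟩) := by
      intro d
      induction d with
      | zero =>
        intro k h
        refine lt_of_le_of_ne (hno k h) ?_
        intro he
        have := π.injective (hv he)
        simp [Fin.ext_iff] at this
      | succ d ihd =>
        intro k h
        have h1 := ihd k (by omega)
        have h2 := hno (k + d + 1) (by omega)
        exact h1.trans_le h2
    intro i j hij
    have hij' : (i : ℕ) < j := hij
    have := hall (j - i - 1) i (by omega)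
    have e : (⟨(i : ℕ) + (j - i - 1) + 1, by omega⟩ : Fin n) = j := by
      simp only [Fin.ext_iff]; omega
    rw [e] at this
    exact this
  have hstep : ∀ π (k : ℕ) (hk : k + 1 < n), v (π ⟨k + 1, hk⟩) < v (π ⟨k, by omega⟩) →
      m π < m (π * Equiv.swap ⟨k, by omega⟩ ⟨k + 1, hk⟩) := by
    intro π k hk hd
    have hne : (⟨k, by omega⟩ : Fin n) ≠ ⟨k + 1, hk⟩ := by simp [Fin.ext_iff]
    have hr := hrk _ _ hd
    have e : ∀ τ : Equiv.Perm (Fin n), m τ = k * rk (τ ⟨k, by omega⟩) +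
        (k + 1) * rk (τ ⟨k + 1, hk⟩) +
        ∑ i ∈ (Finset.univ.erase (⟨k, by omega⟩ : Fin n)).erase ⟨k + 1, hk⟩,
          (i : ℕ) * rk (τ i) := by
      intro τ
      have h1 := Finset.add_sum_erase (Finset.univ : Finset (Fin n))
        (fun i => (i : ℕ) * rk (τ i)) (Finset.mem_univ (⟨k, by omega⟩ : Fin n))
      have h2 := Finset.add_sum_erase (Finset.univ.erase (⟨k, by omega⟩ : Fin n))
        (fun i => (i : ℕ) * rk (τ i)) (a := ⟨k + 1, hk⟩) (by simp [hne.symm])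
      simp only [m]
      rw [← h1, ← h2]
      ring
    rw [e π, e]
    simp only [Equiv.Perm.mul_apply, Equiv.swap_apply_left, Equiv.swap_apply_right]
    have h3 : ∀ i ∈ (Finset.univ.erase (⟨k, by omega⟩ : Fin n)).erase ⟨k + 1, hk⟩,
        (i : ℕ) * rk (π (Equiv.swap ⟨k, by omega⟩ ⟨k + 1, hk⟩ i)) = (i : ℕ) * rk (π i) := by
      intro i hi
      simp only [Finset.mem_erase, Finset.mem_univ, and_true] at hi
      rw [Equiv.swap_apply_of_ne_of_ne hi.2 hi.1]
    rw [Finset.sum_congr rfl h3]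
    nlinarith
  have key : ∀ N : ℕ, ∀ π, n * (n * n) - m π ≤ N → R π → P π := by
    intro N
    induction N with
    | zero =>
      intro π hN hR
      apply h0 π hR
      by_contra hcon
      obtain ⟨k, hk, hd⟩ := hdesc π hcon
      have := hstep π k hk hd
      have := hmb (π * Equiv.swap ⟨k, by omega⟩ ⟨k + 1, hk⟩)
      omega
    | succ N ih =>
      intro π hN hR
      by_cases hcon : StrictMono (v ∘ π)
      · exact h0 π hR hcon
      obtain ⟨k, hk, hd⟩ := hdesc π hcon
      have h1 := hstep π k hk hd
      have h2 := hmb (π * Equiv.swap ⟨k, by omega⟩ ⟨k + 1, hk⟩)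
      obtain ⟨h3, h4⟩ := hs π k hk hR hd
      exact h4 (ih _ (by omega) h3)
  intro π hR
  exact key _ π le_rfl hR

end

section

noncomputable section ModelDefs

abbrev TT : Type := ℝ × ℝ × ℝ

def bes (a b : TT) : Prop := a.2.2 < b.2.1
def con (a b : TT) : Prop := a.2.1 < b.2.1 ∧ b.2.2 < a.2.2
def unl (a b : TT) : Prop := bes a b ∨ bes b a ∨ con a b ∨ con b a
def tok (a : TT) : Prop := a.2.1 < a.2.2
def good (a b : TT) : Prop := tok a ∧ tok b ∧ (bes a b ∨ con a b)

def tkey (a : TT) : ℝ ×ₗ ℝ := toLex (a.1, a.2.1)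

def IsY {n : ℕ} (y : Fin n → TT) : Prop :=
  (∀ i, tok (y i)) ∧ ∀ i j, i ≠ j → (y i).1 = (y j).1 → unl (y i) (y j)

def UU {n : ℕ} (y : Fin n → TT) : Set (Fin n → TT) :=
  {z | (∀ i, tok (z i)) ∧ ∀ i j, ((y i).1 < (y j).1 → (z i).1 < (z j).1) ∧
    ((y i).1 = (y j).1 → (bes (y i) (y j) → bes (z i) (z j)) ∧
      (con (y i) (y j) → con (z i) (z j)))}

variable {G : Type*} [Group G]

open Classical in
def gg (S R : ℕ → G) (k : ℕ) (a b : TT) : G := if bes a b then S k else R k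

structure BR (n : ℕ) (S R : ℕ → G) : Prop where
  far1 : ∀ k l, k + 2 ≤ l → Commute (S k) (S l)
  far2 : ∀ k l, k + 2 ≤ l → Commute (S k) (R l)
  far3 : ∀ k l, k + 2 ≤ l → Commute (R k) (S l)
  far4 : ∀ k l, k + 2 ≤ l → Commute (R k) (R l)
  br1 : ∀ k, k + 2 < n → S k * S (k + 1) * S k = S (k + 1) * S k * S (k + 1)
  br2 : ∀ k, k + 2 < n → S k * S (k + 1) * R k = R (k + 1) * S k * S (k + 1)
  br3 : ∀ k, k + 2 < n → R k * S (k + 1) * S k = S (k + 1) * S k * R (k + 1)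
  br4 : ∀ k, k + 2 < n → R k * R (k + 1) * S k = S (k + 1) * R k * R (k + 1)
  br5 : ∀ k, k + 2 < n → R k * R (k + 1) * R k = R (k + 1) * R k * R (k + 1)

theorem BR.hfar {n : ℕ} {S R : ℕ → G} (h : BR n S R) :
    ∀ k l a b c d, k + 2 ≤ l → Commute (gg S R k a b) (gg S R l c d) := by
  intro k l a b c d hkl
  unfold gg
  split_ifs
  · exact h.far1 k l hkl
  · exact h.far2 k l hkl
  · exact h.far3 k l hkl
  · exact h.far4 k l hkl

theorem BR.hbr {n : ℕ} {S R : ℕ → G} (h : BR n S R) :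
    ∀ k a b c, k + 2 < n → tkey a < tkey b → tkey b < tkey c → good a b → good a c → good b c →
      gg S R k a b * gg S R (k + 1) a c * gg S R k b c =
        gg S R (k + 1) b c * gg S R k a c * gg S R (k + 1) a b := by
  rintro k ⟨a0, a, a'⟩ ⟨b0, b, b'⟩ ⟨c0, c, c'⟩ hk - - ⟨ha, hb, hab⟩ ⟨-, hc, hac⟩ ⟨-, -, hbc⟩
  simp only [bes, con, gg, tok] at *
  by_cases h1 : a' < b
  · have h2 : a' < c := by rcases hbc with h | h <;> linarith
    by_cases h3 : b' < c
    · simpa [h1, h2, h3] using h.br1 k hk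
    · simpa [h1, h2, h3] using h.br2 k hk
  · by_cases h2 : a' < c
    · have h3 : b' < c := by
        rcases hbc with h | h
        · exact h
        · rcases hab with h' | h' <;> linarith
      simpa [h1, h2, h3] using h.br3 k hk
    · by_cases h3 : b' < c
      · simpa [h1, h2, h3] using h.br4 k hk
      · simpa [h1, h2, h3] using h.br5 k hk

theorem mem_UU_self {n : ℕ} {y : Fin n → TT} (hy : IsY y) : y ∈ UU y :=
  ⟨hy.1, fun _ _ => ⟨id, fun _ => ⟨id, id⟩⟩⟩

theorem UU_bes {n : ℕ} {y z : Fin n → TT} (hy : IsY y) (hz : z ∈ UU y) {i j : Fin n}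
    (h : (y i).1 = (y j).1) : bes (z i) (z j) ↔ bes (y i) (y j) := by
  have a1 := hy.1 i
  have a2 := hy.1 j
  have b1 := hz.1 i
  have b2 := hz.1 j
  have c1 := (hz.2 i j).2 h
  have c2 := (hz.2 j i).2 h.symm
  by_cases hij : i = j
  · subst hij
    unfold bes tok at *
    constructor <;> intro h <;> linarith
  have d := hy.2 i j hij h
  refine ⟨fun hh => ?_, c1.1⟩
  unfold unl at d
  rcases d with d | d | d | d
  · exact d
  · have := c2.1 d; unfold bes tok at *; linarith
  · have := c1.2 d; unfold bes con tok at *; linarith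
  · have := c2.2 d; unfold bes con tok at *; linarith

theorem UU_con {n : ℕ} {y z : Fin n → TT} (hy : IsY y) (hz : z ∈ UU y) {i j : Fin n}
    (h : (y i).1 = (y j).1) : con (z i) (z j) ↔ con (y i) (y j) := by
  have a1 := hy.1 i
  have a2 := hy.1 j
  have b1 := hz.1 i
  have b2 := hz.1 j
  have c1 := (hz.2 i j).2 h
  have c2 := (hz.2 j i).2 h.symm
  by_cases hij : i = j
  · subst hij
    unfold con tok at *
    constructor <;> intro h <;> linarith
  have d := hy.2 i j hij h
  refine ⟨fun hh => ?_, c1.2⟩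
  unfold unl at d
  rcases d with d | d | d | d
  · have := c1.1 d; unfold bes con tok at *; linarith
  · have := c2.1 d; unfold bes con tok at *; linarith
  · exact d
  · have := c2.2 d; unfold bes con tok at *; linarith

theorem UU_unl {n : ℕ} {y z : Fin n → TT} (hy : IsY y) (hz : z ∈ UU y) {i j : Fin n}
    (hij : i ≠ j) (h : (y i).1 = (y j).1) : unl (z i) (z j) := by
  have c1 := (hz.2 i j).2 h
  have c2 := (hz.2 j i).2 h.symm
  rcases hy.2 i j hij h with d | d | d | d
  · exact Or.inl (c1.1 d)
  · exact Or.inr (Or.inl (c2.1 d))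
  · exact Or.inr (Or.inr (Or.inl (c1.2 d)))
  · exact Or.inr (Or.inr (Or.inr (c2.2 d)))

theorem UU_tie {n : ℕ} {y z : Fin n → TT} (hz : z ∈ UU y) {i j : Fin n}
    (h : (z i).1 = (z j).1) : (y i).1 = (y j).1 := by
  have h1 := (hz.2 i j).1
  have h2 := (hz.2 j i).1
  rcases lt_trichotomy (y i).1 (y j).1 with a | a | a
  · exact absurd h (h1 a).ne
  · exact a
  · exact absurd h (h2 a).ne'

theorem UU_isY {n : ℕ} {y z : Fin n → TT} (hy : IsY y) (hz : z ∈ UU y) : IsY z :=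
  ⟨hz.1, fun _ _ hij h => UU_unl hy hz hij (UU_tie hz h)⟩

theorem IsY.comp {n : ℕ} {y : Fin n → TT} (hy : IsY y) (τ : Equiv.Perm (Fin n)) : IsY (y ∘ τ) :=
  ⟨fun i => hy.1 _, fun _ _ hij h => hy.2 _ _ (τ.injective.ne hij) h⟩

theorem UU_comp {n : ℕ} {y z : Fin n → TT} (hz : z ∈ UU y) (τ : Equiv.Perm (Fin n)) :
    z ∘ τ ∈ UU (y ∘ τ) :=
  ⟨fun i => hz.1 _, fun _ _ => hz.2 _ _⟩

theorem lo_ne {a b : TT} (h : unl a b) (ha : tok a) (hb : tok b) : a.2.1 ≠ b.2.1 := by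
  unfold unl bes con tok at *
  rintro he
  rcases h with h | h | h | h <;> linarith

theorem good_of {a b : TT} (h : unl a b) (ha : tok a) (hb : tok b) (hl : a.2.1 < b.2.1) :
    good a b := by
  refine ⟨ha, hb, ?_⟩
  unfold unl bes con tok at *
  rcases h with h | h | h | h
  · exact Or.inl h
  · linarith
  · exact Or.inr h
  · linarith

theorem tkey_lt {a b : TT} : tkey a < tkey b ↔ a.1 < b.1 ∨ a.1 = b.1 ∧ a.2.1 < b.2.1 := by
  simp [tkey, Prod.Lex.toLex_lt_toLex]

theorem tkey_inj {n : ℕ} {y : Fin n → TT} (hy : IsY y) : Function.Injective (tkey ∘ y) := by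
  intro i j h
  by_contra hij
  simp only [Function.comp, tkey, EmbeddingLike.apply_eq_iff_eq, Prod.mk.injEq] at h
  exact lo_ne (hy.2 i j hij h.1) (hy.1 i) (hy.1 j) h.2

/-- π refines the levels of y -/
def refi {n : ℕ} (y : Fin n → TT) (π : Equiv.Perm (Fin n)) : Prop :=
  ∀ i j, i < j → (y (π i)).1 ≤ (y (π j)).1

def srt {n : ℕ} (y : Fin n → TT) : Equiv.Perm (Fin n) := Tuple.sort (tkey ∘ y)

theorem srt_mono {n : ℕ} {y : Fin n → TT} (hy : IsY y) : StrictMono (tkey ∘ y ∘ srt y) :=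
  (Tuple.monotone_sort (tkey ∘ y)).strictMono_of_injective
    ((tkey_inj hy).comp (srt y).injective)

theorem srt_unique {n : ℕ} {y : Fin n → TT} (π : Equiv.Perm (Fin n))
    (h : StrictMono (tkey ∘ y ∘ π)) : π = srt y := by
  have h1 : (tkey ∘ y) ∘ π = (tkey ∘ y) ∘ srt y :=
    Tuple.unique_monotone h.monotone (Tuple.monotone_sort (tkey ∘ y))
  have hi : Function.Injective (tkey ∘ y) := by
    have := h.injective
    have h2 := this.comp π.symm.injective
    convert h2 using 1
    funext i; simp
  ext i
  exact congrArg _ (hi (congrFun h1 i))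

theorem srt_comp {n : ℕ} {y : Fin n → TT} (hy : IsY y) (τ : Equiv.Perm (Fin n)) :
    τ * srt (y ∘ τ) = srt y := by
  apply srt_unique
  exact srt_mono (hy.comp τ)

theorem srt_refi {n : ℕ} {y z : Fin n → TT} (hy : IsY y) (hz : z ∈ UU y) : refi y (srt z) := by
  intro i j hij
  by_contra hcon
  push Not at hcon
  have h1 := (hz.2 _ _).1 hcon
  have h2 : tkey _ < tkey _ := srt_mono (UU_isY hy hz) hij
  rw [tkey_lt] at h2
  simp only [Function.comp] at h2
  rcases h2 with h2 | h2
  · linarith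
  · linarith [h2.1]

theorem refi_tie {n : ℕ} {y : Fin n → TT} {π : Equiv.Perm (Fin n)} (h : refi y π) {i j : Fin n}
    (hij : i < j) (hk : tkey (y (π j)) < tkey (y (π i))) :
    (y (π j)).1 = (y (π i)).1 ∧ (y (π j)).2.1 < (y (π i)).2.1 := by
  rw [tkey_lt] at hk
  have := h i j hij
  rcases hk with hk | hk
  · linarith
  · exact hk

theorem refi_good {n : ℕ} {y : Fin n → TT} (hy : IsY y) {π : Equiv.Perm (Fin n)} (h : refi y π)
    {i j : Fin n}
    (hij : i < j) (hk : tkey (y (π j)) < tkey (y (π i))) : good (y (π j)) (y (π i)) := by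
  have := refi_tie h hij hk
  exact good_of (hy.2 _ _ (π.injective.ne hij.ne') this.1) (hy.1 _) (hy.1 _) this.2

abbrev sw {n : ℕ} (k : ℕ) (hk : k + 1 < n) : Equiv.Perm (Fin n) :=
  Equiv.swap ⟨k, by omega⟩ ⟨k + 1, hk⟩

theorem refi_swap {n : ℕ} {y : Fin n → TT} {π : Equiv.Perm (Fin n)} (h : refi y π)
    (k : ℕ) (hk : k + 1 < n) (ht : (y (π ⟨k + 1, hk⟩)).1 = (y (π ⟨k, by omega⟩)).1) :
    refi y (π * sw k hk) := by
  have e : ∀ i, (y ((π * sw k hk) i)).1 = (y (π i)).1 := by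
    intro i
    simp only [Equiv.Perm.mul_apply]
    by_cases h1 : i = ⟨k, by omega⟩
    · subst h1; rw [Equiv.swap_apply_left]; exact ht
    by_cases h2 : i = ⟨k + 1, hk⟩
    · subst h2; rw [Equiv.swap_apply_right]; exact ht.symm
    rw [Equiv.swap_apply_of_ne_of_ne h1 h2]
  intro i j hij
  rw [e, e]
  exact h i j hij

variable {n : ℕ} {S R : ℕ → G}

theorem costF_step (h : BR n S R) {y : Fin n → TT} (hy : IsY y)
    {π : Equiv.Perm (Fin n)} (hπ : refi y π) (k : ℕ) (hk : k + 1 < n)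
    (hd : tkey (y (π ⟨k + 1, hk⟩)) < tkey (y (π ⟨k, by omega⟩))) :
    costF tkey (gg S R) (y ∘ π) = costF tkey (gg S R) (y ∘ (π * sw k hk)) *
      gg S R k (y (π ⟨k + 1, hk⟩)) (y (π ⟨k, by omega⟩)) :=
  costF_swap h.hfar h.hbr (y ∘ π) k hk hd
    (fun _ _ hij hk => refi_good hy hπ hij hk)

theorem costF_unique (h : BR n S R) {y : Fin n → TT} (hy : IsY y) (F : Equiv.Perm (Fin n) → G)
    (hF : ∀ π (k : ℕ) (hk : k + 1 < n), refi y π →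
      tkey (y (π ⟨k + 1, hk⟩)) < tkey (y (π ⟨k, by omega⟩)) →
      F π = F (π * sw k hk) * gg S R k (y (π ⟨k + 1, hk⟩)) (y (π ⟨k, by omega⟩))) :
    ∀ π, refi y π → F π = F (srt y) * costF tkey (gg S R) (y ∘ π) := by
  apply perm_desc_induction (tkey ∘ y) (refi y)
  · intro π hπ hs
    rw [← srt_unique π hs, costF_sorted, mul_one]
    intro i j hij
    exact (hs hij).le
  · exact tkey_inj hy
  · intro π k hk hπ hd
    have h1 := refi_tie hπ (i := ⟨k, by omega⟩) (j := ⟨k + 1, hk⟩) (by simp [Fin.lt_def]) hd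
    refine ⟨refi_swap hπ k hk h1.1, ?_⟩
    intro ih
    rw [hF π k hk hπ hd, costF_step h hy hπ k hk hd, ih, mul_assoc]

def WW (S R : ℕ → G) (y z : Fin n → TT) : G := costF tkey (gg S R) (y ∘ srt z)

theorem WW_comp {y z : Fin n → TT} (hz : IsY z) (τ : Equiv.Perm (Fin n)) :
    WW S R (y ∘ τ) (z ∘ τ) = WW S R y z := by
  unfold WW
  congr 1
  rw [← srt_comp hz τ]
  rfl

theorem WW_cocycle (h : BR n S R) {y z w : Fin n → TT} (hy : IsY y) (hz : z ∈ UU y)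
    (hwz : w ∈ UU z) : WW S R y w = WW S R y z * WW S R z w := by
  have hzY := UU_isY hy hz
  refine costF_unique h hzY (fun π => costF tkey (gg S R) (y ∘ π)) ?_ (srt w) (srt_refi hzY hwz)
  intro π k hk hπ hd
  have hπy : refi y π := by
    intro i j hij
    by_contra hcon
    push Not at hcon
    have h1 := (hz.2 _ _).1 hcon
    have h2 := hπ i j hij
    linarith
  have h1 := refi_tie hπ (i := ⟨k, by omega⟩) (j := ⟨k + 1, hk⟩) (by simp [Fin.lt_def]) hd
  have h2 := UU_tie hz h1.1
  have hgz := refi_good hzY hπ (i := ⟨k, by omega⟩) (j := ⟨k + 1, hk⟩) (by simp [Fin.lt_def]) hd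
  have hb := UU_bes hy hz h2
  have hc := UU_con hy hz h2
  have hlo : (y (π ⟨k + 1, hk⟩)).2.1 < (y (π ⟨k, by omega⟩)).2.1 := by
    have a1 := hy.1 (π ⟨k + 1, hk⟩)
    rcases hgz.2.2 with h3 | h3
    · have := hb.1 h3
      unfold bes tok at *
      linarith
    · exact (hc.1 h3).1
  have hdy : tkey (y (π ⟨k + 1, hk⟩)) < tkey (y (π ⟨k, by omega⟩)) :=
    tkey_lt.2 (Or.inr ⟨h2, hlo⟩)
  have := costF_step h hy hπy k hk hdy
  rw [this]
  congr 1
  classical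
  exact if_congr hb.symm rfl rfl

end ModelDefs

end

section

noncomputable section PresSide

theorem map_cost {α β G K : Type*} [LinearOrder β] [Group G] [Group K] (key : α → β)
    (g : ℕ → α → α → G) (ψ : G →* K) (k : ℕ) (l : List α) :
    ψ (cost key g k l) = cost key (fun k a b => ψ (g k a b)) k l := by
  have h : ∀ (s : List α) (k : ℕ) (a : α),
      ψ (insc key g k a s) = insc key (fun k a b => ψ (g k a b)) k a s := by
    intro s
    induction s with
    | nil => intro k a; simp [insc]
    | cons b s ih =>
      intro k a
      simp only [insc]
      split_ifs
      · simp
      · rw [map_mul, ih]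
  induction l generalizing k with
  | nil => simp [cost]
  | cons a l ih => simp [cost, h, ih]

theorem map_costF {α β G K : Type*} [LinearOrder β] [Group G] [Group K] (key : α → β)
    (g : ℕ → α → α → G) (ψ : G →* K) {n : ℕ} (f : Fin n → α) :
    ψ (costF key g f) = costF key (fun k a b => ψ (g k a b)) f := map_cost _ _ _ _ _

def Sg (n : ℕ) (k : ℕ) : PresentedGroup (uwRels n) :=
  if h : k < n - 1 then PresentedGroup.of (Sum.inr ⟨k, h⟩) else 1

def Rg (n : ℕ) (k : ℕ) : PresentedGroup (uwRels n) :=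
  if h : k < n - 1 then (PresentedGroup.of (Sum.inl ⟨k, h⟩))⁻¹ else 1

theorem rel_far {n : ℕ} (i j : Fin (n - 1)) (h : (i : ℕ) + 2 ≤ (j : ℕ) ∨ (j : ℕ) + 2 ≤ (i : ℕ)) :
    {gρ i * gρ j * (gρ j * gρ i)⁻¹, gσ i * gσ j * (gσ j * gσ i)⁻¹,
      gρ i * gσ j * (gσ j * gρ i)⁻¹} ⊆ uwRels n := by
  intro x hx
  left
  simp only [Set.mem_iUnion]
  exact ⟨i, j, h, hx⟩

theorem rel_br {n : ℕ} (i j : Fin (n - 1)) (h : (j : ℕ) = (i : ℕ) + 1) :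
    {gρ i * gρ j * gρ i * (gρ j * gρ i * gρ j)⁻¹,
      gσ i * gσ j * gσ i * (gσ j * gσ i * gσ j)⁻¹,
      gρ i * gσ j * gσ i * (gσ j * gσ i * gρ j)⁻¹,
      gσ i * gσ j * gρ i * (gρ j * gσ i * gσ j)⁻¹,
      gσ i * gρ j * gρ i * (gρ j * gρ i * gσ j)⁻¹} ⊆ uwRels n := by
  intro x hx
  right
  simp only [Set.mem_iUnion]
  exact ⟨i, j, h, hx⟩

theorem rel_eq {n : ℕ} {a b : FreeGroup (BrGen n)} (h : a * b⁻¹ ∈ uwRels n) :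
    PresentedGroup.mk (uwRels n) a = PresentedGroup.mk (uwRels n) b := by
  have h1 : PresentedGroup.mk (uwRels n) (a * b⁻¹) = 1 := PresentedGroup.one_of_mem h
  rw [map_mul, map_inv, mul_inv_eq_one] at h1
  exact h1

theorem BR_pres (n : ℕ) : BR n (Sg n) (Rg n) := by
  have mkρ : ∀ i : Fin (n - 1), (PresentedGroup.of (Sum.inl i) : PresentedGroup (uwRels n)) =
    PresentedGroup.mk (uwRels n) (gρ i) := fun _ => rfl
  have mkσ : ∀ i : Fin (n - 1), (PresentedGroup.of (Sum.inr i) : PresentedGroup (uwRels n)) =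
    PresentedGroup.mk (uwRels n) (gσ i) := fun _ => rfl
  have f1 : ∀ i j : Fin (n - 1), (i : ℕ) + 2 ≤ (j : ℕ) ∨ (j : ℕ) + 2 ≤ (i : ℕ) →
      Commute (PresentedGroup.of (Sum.inl i) : PresentedGroup (uwRels n))
        (PresentedGroup.of (Sum.inl j)) := by
    intro i j h
    have := rel_eq (rel_far i j h (Or.inl rfl))
    simp only [map_mul] at this
    exact this
  have f2 : ∀ i j : Fin (n - 1), (i : ℕ) + 2 ≤ (j : ℕ) ∨ (j : ℕ) + 2 ≤ (i : ℕ) →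
      Commute (PresentedGroup.of (Sum.inr i) : PresentedGroup (uwRels n))
        (PresentedGroup.of (Sum.inr j)) := by
    intro i j h
    have := rel_eq (rel_far i j h (Or.inr (Or.inl rfl)))
    simp only [map_mul] at this
    exact this
  have f3 : ∀ i j : Fin (n - 1), (i : ℕ) + 2 ≤ (j : ℕ) ∨ (j : ℕ) + 2 ≤ (i : ℕ) →
      Commute (PresentedGroup.of (Sum.inl i) : PresentedGroup (uwRels n))
        (PresentedGroup.of (Sum.inr j)) := by
    intro i j h
    have := rel_eq (rel_far i j h (Or.inr (Or.inr rfl)))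
    simp only [map_mul] at this
    exact this
  constructor
  · intro k l h
    unfold Sg
    split_ifs with h1 h2
    · exact f2 _ _ (Or.inl h)
    all_goals simp
  · intro k l h
    unfold Sg Rg
    split_ifs with h1 h2
    · exact (f3 _ _ (Or.inr h)).symm.inv_right
    all_goals simp
  · intro k l h
    unfold Sg Rg
    split_ifs with h1 h2
    · exact (f3 _ _ (Or.inl h)).inv_left
    all_goals simp
  · intro k l h
    unfold Rg
    split_ifs with h1 h2
    · exact (f1 _ _ (Or.inl h)).inv_inv
    all_goals simp
  · intro k hk
    have := rel_eq (rel_br (n := n) ⟨k, by omega⟩ ⟨k + 1, by omega⟩ rfl (Or.inr (Or.inl rfl)))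
    simp only [map_mul, ← mkρ, ← mkσ] at this
    simpa [Sg, show k < n - 1 by omega, show k + 1 < n - 1 by omega] using this
  · intro k hk
    have := rel_eq (rel_br (n := n) ⟨k, by omega⟩ ⟨k + 1, by omega⟩ rfl
      (Or.inr (Or.inr (Or.inr (Or.inl rfl)))))
    simp only [map_mul, ← mkρ, ← mkσ] at this
    simp only [Sg, Rg, show k < n - 1 by omega, show k + 1 < n - 1 by omega, dif_pos]
    rw [mul_inv_eq_iff_eq_mul, mul_assoc, mul_assoc, eq_inv_mul_iff_mul_eq, ← mul_assoc, ← mul_assoc]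
    exact this.symm
  · intro k hk
    have := rel_eq (rel_br (n := n) ⟨k, by omega⟩ ⟨k + 1, by omega⟩ rfl
      (Or.inr (Or.inr (Or.inl rfl))))
    simp only [map_mul, ← mkρ, ← mkσ] at this
    simp only [Sg, Rg, show k < n - 1 by omega, show k + 1 < n - 1 by omega, dif_pos]
    rw [eq_mul_inv_iff_mul_eq, mul_assoc, mul_assoc, inv_mul_eq_iff_eq_mul, ← mul_assoc, ← mul_assoc]
    exact this.symm
  · intro k hk
    have := rel_eq (rel_br (n := n) ⟨k, by omega⟩ ⟨k + 1, by omega⟩ rfl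
      (Or.inr (Or.inr (Or.inr (Or.inr rfl)))))
    simp only [map_mul, ← mkρ, ← mkσ] at this
    simp only [Sg, Rg, show k < n - 1 by omega, show k + 1 < n - 1 by omega, dif_pos]
    rw [← mul_inv_rev, mul_assoc _ _ (_)⁻¹, ← mul_inv_rev, eq_mul_inv_iff_mul_eq, mul_assoc,
      inv_mul_eq_iff_eq_mul, ← mul_assoc]
    exact this
  · intro k hk
    have := rel_eq (rel_br (n := n) ⟨k, by omega⟩ ⟨k + 1, by omega⟩ rfl (Or.inl rfl))
    simp only [map_mul, ← mkρ, ← mkσ] at this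
    simp only [Sg, Rg, show k < n - 1 by omega, show k + 1 < n - 1 by omega, dif_pos]
    rw [← inv_inj]
    simpa [mul_assoc] using this

/-- the hom out of the presented group -/
theorem exists_hom {K : Type*} [Group K] {n : ℕ} {S R : ℕ → K} (h : BR n S R) :
    ∃ ψ : PresentedGroup (uwRels n) →* K, ∀ k, k + 1 < n → ψ (Sg n k) = S k ∧ ψ (Rg n k) = R k := by
  let f : BrGen n → K := Sum.elim (fun i => (R i)⁻¹) (fun i => S i)
  have hf : ∀ r ∈ uwRels n, FreeGroup.lift f r = 1 := by
    have e1 : ∀ i : Fin (n - 1), FreeGroup.lift f (gρ i) = (R i)⁻¹ := fun i => by simp [gρ, f]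
    have e2 : ∀ i : Fin (n - 1), FreeGroup.lift f (gσ i) = S i := fun i => by simp [gσ, f]
    rintro r (hr | hr)
    · simp only [Set.mem_iUnion] at hr
      obtain ⟨i, j, hij, hr⟩ := hr
      have c1 : Commute (R i) (R j) := by
        rcases hij with hij | hij
        · exact h.far4 _ _ hij
        · exact (h.far4 _ _ hij).symm
      have c2 : Commute (S i) (S j) := by
        rcases hij with hij | hij
        · exact h.far1 _ _ hij
        · exact (h.far1 _ _ hij).symm
      have c3 : Commute (R i) (S j) := by
        rcases hij with hij | hij
        · exact h.far3 _ _ hij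
        · exact (h.far2 _ _ hij).symm
      rcases hr with rfl | rfl | rfl
      all_goals
        rw [map_mul, map_inv, mul_inv_eq_one]
        simp only [map_mul, e1, e2]
      · exact c1.inv_inv.eq
      · exact c2.eq
      · exact c3.inv_left.eq
    · simp only [Set.mem_iUnion] at hr
      obtain ⟨i, j, hij, hr⟩ := hr
      have hi : (i : ℕ) + 2 < n := by have := j.2; omega
      have b1 := h.br1 i hi
      have b2 := h.br2 i hi
      have b3 := h.br3 i hi
      have b4 := h.br4 i hi
      have b5 := h.br5 i hi
      rcases hr with rfl | rfl | rfl | rfl | rfl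
      all_goals
        rw [map_mul, map_inv, mul_inv_eq_one]
        simp only [map_mul, e1, e2, hij]
      · rw [← inv_inj]
        simpa [mul_assoc] using b5
      · exact b1
      · rw [eq_mul_inv_iff_mul_eq, mul_assoc, mul_assoc, inv_mul_eq_iff_eq_mul, ← mul_assoc,
          ← mul_assoc]
        exact b3.symm
      · rw [mul_inv_eq_iff_eq_mul, mul_assoc, mul_assoc, eq_inv_mul_iff_mul_eq, ← mul_assoc,
          ← mul_assoc]
        exact b2.symm
      · rw [mul_assoc, ← mul_inv_rev, eq_inv_mul_iff_mul_eq, ← mul_assoc,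
          mul_inv_eq_iff_eq_mul, ← mul_assoc]
        exact b4
  refine ⟨PresentedGroup.toGroup hf, ?_⟩
  intro k hk
  have hk' : k < n - 1 := by omega
  constructor
  · simp [Sg, hk', f]
  · simp [Rg, hk', f]

end PresSide

end

section

noncomputable section AbsSide

def pt {n : ℕ} (π : Equiv.Perm (Fin n)) (y : Fin n → TT) : Fin n → TT :=
  fun i => ((((π⁻¹ i : Fin n) : ℕ) : ℝ), (y i).2)

def y00 (n : ℕ) : Fin n → TT := fun i => (((i : ℕ) : ℝ), 0, 1)

theorem y00_isY (n : ℕ) : IsY (y00 n) := by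
  refine ⟨fun i => by simp [tok, y00], fun i j hij h => ?_⟩
  simp [y00] at h
  exact absurd (Fin.ext h) hij

theorem pt_comp {n : ℕ} (π τ : Equiv.Perm (Fin n)) (y : Fin n → TT) :
    pt π (y ∘ τ) = pt (τ * π) y ∘ τ := by
  funext i
  simp [pt]

theorem pt_mem {n : ℕ} {y z : Fin n → TT} (hz : z ∈ UU y) {π : Equiv.Perm (Fin n)}
    (hπ : refi y π) : pt π z ∈ UU y := by
  refine ⟨hz.1, fun i j => ⟨fun h => ?_, (hz.2 i j).2⟩⟩
  simp only [pt, Nat.cast_lt, Fin.val_fin_lt]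
  by_contra hcon
  push Not at hcon
  rcases hcon.lt_or_eq with h1 | h1
  · have := hπ _ _ h1
    simp at this
    linarith
  · have := π⁻¹.injective h1
    subst this
    exact lt_irrefl _ h

theorem pt_one_mem {n : ℕ} {z : Fin n → TT} (hz : ∀ i, tok (z i)) : pt 1 z ∈ UU (y00 n) := by
  refine ⟨hz, fun i j => ⟨fun h => ?_, fun h => ?_⟩⟩
  · simpa [pt, y00] using h
  · have : i = j := by simpa [y00, Fin.ext_iff] using h
    subst this
    simp [bes, con, y00]

/-- wall point -/
def wl {n : ℕ} (l : ℕ → ℕ) (y : Fin n → TT) : Fin n → TT := fun i => ((l i : ℝ), (y i).2)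

theorem wl_refi {n : ℕ} {l : ℕ → ℕ} (hl : Monotone l) (y : Fin n → TT) : refi (wl l y) 1 := by
  intro i j hij
  simp only [wl, Equiv.Perm.one_apply, Nat.cast_le]
  exact hl hij.le

variable {K : Type*} [Group K] {n : ℕ} (k : (Fin n → TT) → (Fin n → TT) → K)

def hh (y : Fin n → TT) (π π' : Equiv.Perm (Fin n)) : K :=
  k (y00 n) (pt 1 (y ∘ π)) * k (pt π y) (pt π' y) * k (pt 1 (y ∘ π')) (y00 n)

def yS (n : ℕ) : Fin n → TT := fun i => (0, 2 * (i : ℕ), 2 * (i : ℕ) + 1)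
def yR (n : ℕ) : Fin n → TT := fun i => (0, (i : ℕ), 2 * n + 1 - (i : ℕ))

def SK (j : ℕ) : K := if h : j + 1 < n then hh k (yS n) 1 (sw j h) else 1
def RK (j : ℕ) : K := if h : j + 1 < n then hh k (yR n) 1 (sw j h) else 1

def mrg (j i : ℕ) : ℕ := if i ≤ j then i else i - 1

theorem mrg_mono (j : ℕ) : Monotone (mrg j) := by
  intro a b h
  unfold mrg
  split_ifs <;> omega

theorem mrg_eq {j a b : ℕ} (h : mrg j a = mrg j b) :
    a = b ∨ (a = j ∧ b = j + 1) ∨ (a = j + 1 ∧ b = j) := by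
  unfold mrg at h
  split_ifs at h <;> omega

theorem mrg_self {j : ℕ} : mrg j (j + 1) = mrg j j := by
  unfold mrg
  simp

variable {k}

section
variable (hcoc : ∀ t u v w, IsY t → u ∈ UU t → v ∈ UU t → w ∈ UU t → k u v * k v w = k u w)
  (heq : ∀ τ : Equiv.Perm (Fin n), ∀ u v, k (u ∘ τ) (v ∘ τ) = k u v)
include hcoc

theorem k_self {t u : Fin n → TT} (ht : IsY t) (hu : u ∈ UU t) : k u u = 1 := by
  have := hcoc t u u u ht hu hu hu
  simpa using this

theorem k_inv {t u v : Fin n → TT} (ht : IsY t) (hu : u ∈ UU t) (hv : v ∈ UU t) :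
    k u v = (k v u)⁻¹ := by
  rw [eq_inv_iff_mul_eq_one, hcoc t u v u ht hu hv hu, k_self hcoc ht hu]

theorem hh_cocycle {y : Fin n → TT} (hy : IsY y) {π π' π'' : Equiv.Perm (Fin n)}
    (h : refi y π) (h' : refi y π') (h'' : refi y π'') :
    hh k y π π' * hh k y π' π'' = hh k y π π'' := by
  have hs := mem_UU_self hy
  have e := hcoc y _ _ _ hy (pt_mem hs h) (pt_mem hs h') (pt_mem hs h'')
  have e1 : k (pt 1 (y ∘ π')) (y00 n) = (k (y00 n) (pt 1 (y ∘ π')))⁻¹ :=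
    k_inv hcoc (y00_isY n) (pt_one_mem (fun i => hy.1 _)) (mem_UU_self (y00_isY n))
  unfold hh
  rw [← e, e1]
  group

include heq

omit hcoc in
theorem k_pt (y z : Fin n → TT) (π : Equiv.Perm (Fin n)) :
    k (pt π y) (pt π z) = k (pt 1 (y ∘ π)) (pt 1 (z ∘ π)) := by
  rw [pt_comp, pt_comp, heq, mul_one]

omit hcoc in
theorem hh_comp (y : Fin n → TT) (τ π π' : Equiv.Perm (Fin n)) :
    hh k (y ∘ τ) π π' = hh k y (τ * π) (τ * π') := by
  unfold hh
  rw [pt_comp π τ, pt_comp π' τ, heq]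
  rfl

theorem hh_type {y z : Fin n → TT} (hy : IsY y) (hz : z ∈ UU y) {π π' : Equiv.Perm (Fin n)}
    (h : refi y π) (h' : refi y π') : hh k y π π' = hh k z π π' := by
  have hs := mem_UU_self hy
  have h0 := y00_isY n
  have m0 := mem_UU_self h0
  have m1 : pt 1 (y ∘ π) ∈ UU (y00 n) := pt_one_mem (fun i => hy.1 _)
  have m2 : pt 1 (y ∘ π') ∈ UU (y00 n) := pt_one_mem (fun i => hy.1 _)
  have m3 : pt 1 (z ∘ π) ∈ UU (y00 n) := pt_one_mem (fun i => hz.1 _)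
  have m4 : pt 1 (z ∘ π') ∈ UU (y00 n) := pt_one_mem (fun i => hz.1 _)
  have e1 := hcoc y _ _ _ hy (pt_mem hs h) (pt_mem hz h) (pt_mem hs h')
  have e2 := hcoc y _ _ _ hy (pt_mem hz h) (pt_mem hz h') (pt_mem hs h')
  rw [k_pt heq] at e1
  rw [k_pt heq z y] at e2
  unfold hh
  rw [← e1, ← e2, ← hcoc _ _ _ _ h0 m0 m1 m3, ← hcoc _ _ _ _ h0 m4 m2 m0]
  group

theorem hh_gen_aux {y z : Fin n → TT} (j : ℕ) (hj : j + 1 < n) (hy : ∀ i, tok (y i))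
    (hz : ∀ i, tok (z i)) (hg : good (y ⟨j, by omega⟩) (y ⟨j + 1, hj⟩))
    (hb : bes (y ⟨j, by omega⟩) (y ⟨j + 1, hj⟩) → bes (z ⟨j, by omega⟩) (z ⟨j + 1, hj⟩))
    (hc : con (y ⟨j, by omega⟩) (y ⟨j + 1, hj⟩) → con (z ⟨j, by omega⟩) (z ⟨j + 1, hj⟩)) :
    hh k y 1 (sw j hj) = hh k z 1 (sw j hj) := by
  have hl : ∀ a b : Fin n, (wl (mrg j) y a).1 = (wl (mrg j) y b).1 → a = b ∨
      (a = ⟨j, by omega⟩ ∧ b = ⟨j + 1, hj⟩) ∨ (a = ⟨j + 1, hj⟩ ∧ b = ⟨j, by omega⟩) := by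
    intro a b h
    simp only [wl, Nat.cast_inj] at h
    simpa [Fin.ext_iff] using mrg_eq h
  have hyY : IsY (wl (mrg j) y) := by
    refine ⟨hy, fun a b hab h => ?_⟩
    rcases hl a b h with h | ⟨rfl, rfl⟩ | ⟨rfl, rfl⟩
    · exact absurd h hab
    · rcases hg.2.2 with h | h
      · exact Or.inl h
      · exact Or.inr (Or.inr (Or.inl h))
    · rcases hg.2.2 with h | h
      · exact Or.inr (Or.inl h)
      · exact Or.inr (Or.inr (Or.inr h))
  have hzU : wl (mrg j) z ∈ UU (wl (mrg j) y) := by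
    refine ⟨hz, fun a b => ⟨id, fun h => ?_⟩⟩
    rcases hl a b h with h | ⟨rfl, rfl⟩ | ⟨rfl, rfl⟩
    · subst h
      have := hy a
      unfold bes con wl tok at *
      constructor <;> intro h
      · simp at h; linarith
      · simp at h
    · exact ⟨hb, hc⟩
    · obtain ⟨g1, g2, g3⟩ := hg
      constructor <;> intro h <;> exfalso <;>
      · unfold bes con wl tok at *
        simp at h
        rcases g3 with g3 | g3 <;> linarith
  have r1 := wl_refi (mrg_mono j) y
  have r2 : refi (wl (mrg j) y) (sw j hj) := by
    have := refi_swap r1 j hj (by simp [wl, mrg_self])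
    simpa using this
  exact hh_type hcoc heq hyY hzU r1 r2

theorem hh_gen {y : Fin n → TT} (j : ℕ) (hj : j + 1 < n) (hy : ∀ i, tok (y i))
    (hg : good (y ⟨j, by omega⟩) (y ⟨j + 1, hj⟩)) :
    hh k y 1 (sw j hj) = gg (SK k) (RK k) j (y ⟨j, by omega⟩) (y ⟨j + 1, hj⟩) := by
  unfold gg
  split_ifs with h
  · simp only [SK, hj, dif_pos]
    refine hh_gen_aux hcoc heq j hj hy ?_ hg ?_ ?_
    · intro i
      simp [tok, yS]
    · intro _
      simp only [bes, yS]
      push_cast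
      linarith
    · intro h'
      have := hg.1
      have := hg.2.1
      unfold bes con tok at *
      linarith
  · simp only [RK, hj, dif_pos]
    refine hh_gen_aux hcoc heq j hj hy ?_ hg (fun h' => absurd h' h) ?_
    · intro i
      have : ((i : ℕ) : ℝ) < n := by exact_mod_cast i.2
      simp only [tok, yR]
      linarith
    · intro _
      simp only [con, yR]
      push_cast
      constructor <;> linarith

theorem hh_step {y : Fin n → TT} (hy : ∀ i, tok (y i)) (π : Equiv.Perm (Fin n)) (j : ℕ)
    (hj : j + 1 < n) (hg : good (y (π ⟨j, by omega⟩)) (y (π ⟨j + 1, hj⟩))) :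
    hh k y π (π * sw j hj) = gg (SK k) (RK k) j (y (π ⟨j, by omega⟩)) (y (π ⟨j + 1, hj⟩)) := by
  have := hh_gen hcoc heq (y := y ∘ π) j hj (fun i => hy _) hg
  rw [hh_comp heq, mul_one] at this
  exact this

end
end AbsSide

end

section

noncomputable section AbsMain

theorem fne {n : ℕ} {a b : Fin n} (h : (a : ℕ) ≠ b) : a ≠ b := fun e => h (congrArg _ e)

theorem sw_braid {n : ℕ} (j : ℕ) (hj : j + 2 < n) :
    sw (n := n) j (by omega) * sw (j + 1) hj * sw j (by omega) =
      sw (j + 1) hj * sw j (by omega) * sw (j + 1) hj := by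
  have a : (⟨j, by omega⟩ : Fin n) ≠ ⟨j + 1, by omega⟩ := fne (show j ≠ j + 1 by omega)
  have b : (⟨j, by omega⟩ : Fin n) ≠ ⟨j + 1 + 1, by omega⟩ := fne (show j ≠ j + 1 + 1 by omega)
  have c : (⟨j + 1, by omega⟩ : Fin n) ≠ ⟨j + 1 + 1, by omega⟩ :=
    fne (show j + 1 ≠ j + 1 + 1 by omega)
  have h1 := Equiv.swap_mul_swap_mul_swap a b
  have h2 := Equiv.swap_mul_swap_mul_swap c.symm b.symm
  have e1 := Equiv.swap_comm (⟨j + 1, by omega⟩ : Fin n) ⟨j, by omega⟩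
  have e2 := Equiv.swap_comm (⟨j + 1 + 1, by omega⟩ : Fin n) ⟨j + 1, by omega⟩
  rw [e1, e2] at h2
  exact h2.trans ((Equiv.swap_comm _ _).trans h1.symm)

theorem sw_comm {n : ℕ} (j l : ℕ) (hj : j + 1 < n) (hl : l + 1 < n) (h : j + 2 ≤ l) :
    sw (n := n) j hj * sw l hl = sw l hl * sw j hj := by
  apply Equiv.Perm.Disjoint.commute
  rw [Equiv.Perm.disjoint_iff_disjoint_support, Equiv.Perm.support_swap, Equiv.Perm.support_swap]
  · simp [Fin.ext_iff]; omega
  · simp [Fin.ext_iff]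
  · simp [Fin.ext_iff]

def mrg22 (j l i : ℕ) : ℕ := if i = j + 1 then j else if i = l + 1 then l else i

def mrg3 (j i : ℕ) : ℕ := if i ≤ j then i else if i ≤ j + 2 then j else i

theorem mrg3_mono (j : ℕ) : Monotone (mrg3 j) := by
  intro a b h
  unfold mrg3
  split_ifs <;> omega

variable {K : Type*} [Group K] {n : ℕ} {k : (Fin n → TT) → (Fin n → TT) → K}
variable (hcoc : ∀ t u v w, IsY t → u ∈ UU t → v ∈ UU t → w ∈ UU t → k u v * k v w = k u w)
  (heq : ∀ τ : Equiv.Perm (Fin n), ∀ u v, k (u ∘ τ) (v ∘ τ) = k u v)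
include hcoc heq

theorem hex (j : ℕ) (hj : j + 2 < n) (a b c : TT) (hab : good a b) (hac : good a c)
    (hbc : good b c) :
    gg (SK k) (RK k) j a b * gg (SK k) (RK k) (j + 1) a c * gg (SK k) (RK k) j b c =
      gg (SK k) (RK k) (j + 1) b c * gg (SK k) (RK k) j a c * gg (SK k) (RK k) (j + 1) a b := by
  let y : Fin n → TT := fun i => if (i : ℕ) = j then a else if (i : ℕ) = j + 1 then b else c
  have hy : ∀ i, tok (y i) := by
    intro i
    simp only [y]
    split_ifs
    · exact hab.1
    · exact hab.2.1
    · exact hac.2.1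
  let i0 : Fin n := ⟨j, by omega⟩
  let i1 : Fin n := ⟨j + 1, by omega⟩
  let i2 : Fin n := ⟨j + 1 + 1, by omega⟩
  let s : Equiv.Perm (Fin n) := sw j (by omega)
  let s' : Equiv.Perm (Fin n) := sw (j + 1) hj
  have y0 : y i0 = a := by simp [y, i0]
  have y1 : y i1 = b := by simp [y, i1]
  have y2 : y i2 = c := by simp [y, i2, show j + 1 + 1 ≠ j by omega]
  have s0 : s i0 = i1 := Equiv.swap_apply_left _ _
  have s1 : s i1 = i0 := Equiv.swap_apply_right _ _
  have s2 : s i2 = i2 := Equiv.swap_apply_of_ne_of_ne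
    (fne (show j + 1 + 1 ≠ j by omega)) (fne (show j + 1 + 1 ≠ j + 1 by omega))
  have t0 : s' i0 = i0 := Equiv.swap_apply_of_ne_of_ne
    (fne (show j ≠ j + 1 by omega)) (fne (show j ≠ j + 1 + 1 by omega))
  have t1 : s' i1 = i2 := Equiv.swap_apply_left _ _
  have t2 : s' i2 = i1 := Equiv.swap_apply_right _ _
  let t := wl (mrg3 j) y
  have l0 : (t i0).1 = j := by simp [t, wl, mrg3, i0]
  have l1 : (t i1).1 = j := by simp [t, wl, mrg3, i1]
  have l2 : (t i2).1 = j := by simp [t, wl, mrg3, i2]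
  have htY : IsY t := by
    refine ⟨hy, fun p q hpq h => ?_⟩
    have h' : mrg3 j p = mrg3 j q := by simpa [t, wl] using h
    have hpq' : (p : ℕ) ≠ q := fun h => hpq (Fin.ext h)
    have hp : ((p : ℕ) = j ∨ (p : ℕ) = j + 1 ∨ (p : ℕ) = j + 2) ∧
        ((q : ℕ) = j ∨ (q : ℕ) = j + 1 ∨ (q : ℕ) = j + 2) := by
      unfold mrg3 at h'
      split_ifs at h' <;> omega
    have hu : unl (y p) (y q) := by
      have gu : ∀ {a b : TT}, good a b → unl a b := fun h => by
        rcases h.2.2 with h | h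
        · exact Or.inl h
        · exact Or.inr (Or.inr (Or.inl h))
      have gu' : ∀ {a b : TT}, good a b → unl b a := fun h => by
        rcases h.2.2 with h | h
        · exact Or.inr (Or.inl h)
        · exact Or.inr (Or.inr (Or.inr h))
      simp only [y]
      rcases hp with ⟨hp | hp | hp, hq | hq | hq⟩
      all_goals first | omega | skip
      all_goals simp [hp, hq]
      · exact gu hab
      · exact gu hac
      · exact gu' hab
      · exact gu hbc
      · exact gu' hac
      · exact gu' hbc
    exact hu
  have r0 : refi t 1 := wl_refi (mrg3_mono j) y
  have ra : refi t s := by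
    have := refi_swap r0 j (by omega) (l1.trans l0.symm)
    rwa [one_mul] at this
  have rb : refi t s' := by
    have := refi_swap r0 (j + 1) hj (l2.trans l1.symm)
    rwa [one_mul] at this
  have rab : refi t (s * s') := refi_swap ra (j + 1) hj (by
    change (t (s i2)).1 = (t (s i1)).1
    rw [s2, s1, l2, l0])
  have rba : refi t (s' * s) := refi_swap rb j (by omega) (by
    change (t (s' i1)).1 = (t (s' i0)).1
    rw [t1, t0, l2, l0])
  have raba : refi t (s * s' * s) := refi_swap rab j (by omega) (by
    change (t (s (s' i1))).1 = (t (s (s' i0))).1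
    rw [t1, t0, s2, s0, l2, l1])
  have hS : ∀ (π : Equiv.Perm (Fin n)) (j : ℕ)
    (hj : j + 1 < n) (a b : TT), y (π ⟨j, by omega⟩) = a → y (π ⟨j + 1, hj⟩) = b → good a b →
    hh k t π (π * sw j hj) = gg (SK k) (RK k) j a b := by
    rintro π j hj a b rfl rfl h
    exact hh_step hcoc heq hy π j hj h
  have h1 := hS 1 j (by omega) a b y0 y1 hab
  have h2 := hS s (j + 1) hj a c ((congrArg y s1).trans y0) ((congrArg y s2).trans y2) hac
  have h3 := hS (s * s') j (by omega) b c
    (by change y (s (s' i0)) = b; rw [t0, s0, y1])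
    (by change y (s (s' i1)) = c; rw [t1, s2, y2]) hbc
  have g1 := hS 1 (j + 1) hj b c y1 y2 hbc
  have g2 := hS s' j (by omega) a c ((congrArg y t0).trans y0) ((congrArg y t1).trans y2) hac
  have g3 := hS (s' * s) (j + 1) hj a b
    (by change y (s' (s i1)) = a; rw [s1, t0, y0])
    (by change y (s' (s i2)) = b; rw [s2, t2, y1]) hab
  rw [one_mul] at h1 g1
  rw [← h1, ← h2, ← h3, ← g1, ← g2, ← g3]
  have hbd : s' * s * s' = s * s' * s := (sw_braid j hj).symm
  change hh k t 1 s * hh k t s (s * s') * hh k t (s * s') (s * s' * s) =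
    hh k t 1 s' * hh k t s' (s' * s) * hh k t (s' * s) (s' * s * s')
  rw [hbd, hh_cocycle hcoc htY r0 ra rab, hh_cocycle hcoc htY r0 rab raba,
    hh_cocycle hcoc htY r0 rb rba, hh_cocycle hcoc htY r0 rba raba]

omit hcoc heq in
theorem mrg22_mono (j l : ℕ) : Monotone (mrg22 j l) := by
  intro a b h
  unfold mrg22
  split_ifs <;> omega

theorem sqr (j l : ℕ) (hjl : j + 2 ≤ l) (hl : l + 1 < n) (a b c d : TT) (hab : good a b)
    (hcd : good c d) : Commute (gg (SK k) (RK k) j a b) (gg (SK k) (RK k) l c d) := by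
  have hj : j + 1 < n := by omega
  let y : Fin n → TT := fun i => if (i : ℕ) = j then a else if (i : ℕ) = j + 1 then b else
    if (i : ℕ) = l then c else d
  have hy : ∀ i, tok (y i) := by
    intro i
    simp only [y]
    split_ifs
    · exact hab.1
    · exact hab.2.1
    · exact hcd.1
    · exact hcd.2.1
  let i0 : Fin n := ⟨j, by omega⟩
  let i1 : Fin n := ⟨j + 1, by omega⟩
  let l0 : Fin n := ⟨l, by omega⟩
  let l1 : Fin n := ⟨l + 1, by omega⟩
  let s : Equiv.Perm (Fin n) := sw j hj
  let s' : Equiv.Perm (Fin n) := sw l hl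
  have y0 : y i0 = a := by simp [y, i0]
  have y1 : y i1 = b := by simp [y, i1]
  have y2 : y l0 = c := by simp [y, l0, show l ≠ j by omega, show l ≠ j + 1 by omega]
  have y3 : y l1 = d := by simp [y, l1, show l + 1 ≠ j by omega, show l ≠ j by omega]
  have sl0 : s l0 = l0 := Equiv.swap_apply_of_ne_of_ne
    (fne (show l ≠ j by omega)) (fne (show l ≠ j + 1 by omega))
  have sl1 : s l1 = l1 := Equiv.swap_apply_of_ne_of_ne
    (fne (show l + 1 ≠ j by omega)) (fne (show l + 1 ≠ j + 1 by omega))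
  have si0 : s' i0 = i0 := Equiv.swap_apply_of_ne_of_ne
    (fne (show j ≠ l by omega)) (fne (show j ≠ l + 1 by omega))
  have si1 : s' i1 = i1 := Equiv.swap_apply_of_ne_of_ne
    (fne (show j + 1 ≠ l by omega)) (fne (show j + 1 ≠ l + 1 by omega))
  let t := wl (mrg22 j l) y
  have lm : (t i1).1 = (t i0).1 := by
    have : mrg22 j l (j + 1) = mrg22 j l j := by
      unfold mrg22
      split_ifs <;> omega
    change ((mrg22 j l (j + 1) : ℕ) : ℝ) = (mrg22 j l j : ℕ)
    rw [this]
  have ll : (t l1).1 = (t l0).1 := by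
    have : mrg22 j l (l + 1) = mrg22 j l l := by
      unfold mrg22
      split_ifs <;> omega
    change ((mrg22 j l (l + 1) : ℕ) : ℝ) = (mrg22 j l l : ℕ)
    rw [this]
  have htY : IsY t := by
    refine ⟨hy, fun p q hpq h => ?_⟩
    have h' : mrg22 j l p = mrg22 j l q := by simpa [t, wl] using h
    have hpq' : (p : ℕ) ≠ q := fun h => hpq (Fin.ext h)
    have hp : ((p : ℕ) = j ∧ (q : ℕ) = j + 1) ∨ ((p : ℕ) = j + 1 ∧ (q : ℕ) = j) ∨
        ((p : ℕ) = l ∧ (q : ℕ) = l + 1) ∨ ((p : ℕ) = l + 1 ∧ (q : ℕ) = l) := by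
      unfold mrg22 at h'
      split_ifs at h' <;> omega
    have gu : ∀ {a b : TT}, good a b → unl a b := fun h => by
      rcases h.2.2 with h | h
      · exact Or.inl h
      · exact Or.inr (Or.inr (Or.inl h))
    have gu' : ∀ {a b : TT}, good a b → unl b a := fun h => by
      rcases h.2.2 with h | h
      · exact Or.inr (Or.inl h)
      · exact Or.inr (Or.inr (Or.inr h))
    have hu : unl (y p) (y q) := by
      rcases hp with ⟨hp, hq⟩ | ⟨hp, hq⟩ | ⟨hp, hq⟩ | ⟨hp, hq⟩
      · rw [show p = i0 from Fin.ext hp, show q = i1 from Fin.ext hq, y0, y1]; exact gu hab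
      · rw [show p = i1 from Fin.ext hp, show q = i0 from Fin.ext hq, y0, y1]; exact gu' hab
      · rw [show p = l0 from Fin.ext hp, show q = l1 from Fin.ext hq, y2, y3]; exact gu hcd
      · rw [show p = l1 from Fin.ext hp, show q = l0 from Fin.ext hq, y2, y3]; exact gu' hcd
    exact hu
  have r0 : refi t 1 := wl_refi (mrg22_mono j l) y
  have ra : refi t s := by
    have := refi_swap r0 j (by omega) lm
    rwa [one_mul] at this
  have rb : refi t s' := by
    have := refi_swap r0 l hl ll
    rwa [one_mul] at this
  have rab : refi t (s * s') := refi_swap ra l hl (by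
    change (t (s l1)).1 = (t (s l0)).1
    rw [sl0, sl1, ll])
  have hS : ∀ (π : Equiv.Perm (Fin n)) (j : ℕ)
    (hj : j + 1 < n) (a b : TT), y (π ⟨j, by omega⟩) = a → y (π ⟨j + 1, hj⟩) = b → good a b →
    hh k t π (π * sw j hj) = gg (SK k) (RK k) j a b := by
    rintro π j hj a b rfl rfl h
    exact hh_step hcoc heq hy π j hj h
  have h1 := hS 1 j hj a b y0 y1 hab
  have h2 := hS s l hl c d ((congrArg y sl0).trans y2) ((congrArg y sl1).trans y3) hcd
  have g1 := hS 1 l hl c d y2 y3 hcd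
  have g2 := hS s' j hj a b ((congrArg y si0).trans y0) ((congrArg y si1).trans y1) hab
  rw [one_mul] at h1 g1
  have hbd : s' * s = s * s' := (sw_comm j l hj hl hjl).symm
  have e1 : hh k t 1 s * hh k t s (s * s') = hh k t 1 s' * hh k t s' (s' * s) := by
    rw [hbd, hh_cocycle hcoc htY r0 ra rab, hh_cocycle hcoc htY r0 rb rab]
  rw [h2, g2] at e1
  change hh k t 1 s = _ at h1
  change hh k t 1 s' = _ at g1
  rw [h1, g1] at e1
  exact e1

theorem BR_K : BR n (SK k) (RK k) := by
  have bS : good (0, 0, 1) (0, 2, 3) := by norm_num [good, tok, bes, con]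
  have bR : good (0, 0, 10) (0, 1, 9) := by norm_num [good, tok, bes, con]
  have eS : ∀ j, gg (SK k) (RK k) j (0, 0, 1) (0, 2, 3) = SK k j := by
    intro j; simp only [gg, bes]; norm_num
  have eR : ∀ j, gg (SK k) (RK k) j (0, 0, 10) (0, 1, 9) = RK k j := by
    intro j; simp only [gg, bes]; norm_num
  have z1 : ∀ l, ¬ (l + 1 < n) → SK k l = 1 := fun l h => by simp [SK, h]
  have z2 : ∀ l, ¬ (l + 1 < n) → RK k l = 1 := fun l h => by simp [RK, h]
  constructor
  · intro j l h
    by_cases hl : l + 1 < n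
    · simpa only [eS, eR] using sqr hcoc heq j l h hl _ _ _ _ bS bS
    · rw [z1 l hl]; exact Commute.one_right _
  · intro j l h
    by_cases hl : l + 1 < n
    · simpa only [eS, eR] using sqr hcoc heq j l h hl _ _ _ _ bS bR
    · rw [z2 l hl]; exact Commute.one_right _
  · intro j l h
    by_cases hl : l + 1 < n
    · simpa only [eS, eR] using sqr hcoc heq j l h hl _ _ _ _ bR bS
    · rw [z1 l hl]; exact Commute.one_right _
  · intro j l h
    by_cases hl : l + 1 < n
    · simpa only [eS, eR] using sqr hcoc heq j l h hl _ _ _ _ bR bR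
    · rw [z2 l hl]; exact Commute.one_right _
  · intro j hj
    have := hex hcoc heq j hj (0, 0, 1) (0, 2, 3) (0, 4, 5) (by norm_num [good, tok, bes, con])
      (by norm_num [good, tok, bes, con]) (by norm_num [good, tok, bes, con])
    norm_num [gg, bes] at this
    exact this
  · intro j hj
    have := hex hcoc heq j hj (0, 0, 1) (0, 2, 5) (0, 3, 4) (by norm_num [good, tok, bes, con])
      (by norm_num [good, tok, bes, con]) (by norm_num [good, tok, bes, con])
    norm_num [gg, bes] at this
    exact this
  · intro j hj
    have := hex hcoc heq j hj (0, 0, 3) (0, 1, 2) (0, 4, 5) (by norm_num [good, tok, bes, con])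
      (by norm_num [good, tok, bes, con]) (by norm_num [good, tok, bes, con])
    norm_num [gg, bes] at this
    exact this
  · intro j hj
    have := hex hcoc heq j hj (0, 0, 10) (0, 1, 2) (0, 3, 4) (by norm_num [good, tok, bes, con])
      (by norm_num [good, tok, bes, con]) (by norm_num [good, tok, bes, con])
    norm_num [gg, bes] at this
    exact this
  · intro j hj
    have := hex hcoc heq j hj (0, 0, 10) (0, 1, 9) (0, 2, 8) (by norm_num [good, tok, bes, con])
      (by norm_num [good, tok, bes, con]) (by norm_num [good, tok, bes, con])
    norm_num [gg, bes] at this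
    exact this

end AbsMain

end

section

noncomputable section AbsFinal

theorem abs_main {K : Type*} [Group K] {n : ℕ} (k : (Fin n → TT) → (Fin n → TT) → K)
    (hcoc : ∀ t u v w, IsY t → u ∈ UU t → v ∈ UU t → w ∈ UU t → k u v * k v w = k u w)
    (heq : ∀ τ : Equiv.Perm (Fin n), ∀ u v, k (u ∘ τ) (v ∘ τ) = k u v)
    (hgen : ∀ (H : Subgroup K) (b : (Fin n → TT) → K),
      (∀ τ : Equiv.Perm (Fin n), ∀ u, IsY u → b (u ∘ τ) = b u) →
      (∀ t u v, IsY t → u ∈ UU t → v ∈ UU t → b u * k u v * (b v)⁻¹ ∈ H) →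
      ∀ γ, b (y00 n) * γ * (b (y00 n))⁻¹ ∈ H)
    (Φ : K →* PresentedGroup (uwRels n)) (d : (Fin n → TT) → PresentedGroup (uwRels n))
    (hd : ∀ τ : Equiv.Perm (Fin n), ∀ u, IsY u → d (u ∘ τ) = d u)
    (hΦ : ∀ t u v, IsY t → u ∈ UU t → v ∈ UU t →
      Φ (k u v) = d u * (WW (Sg n) (Rg n) t u)⁻¹ * WW (Sg n) (Rg n) t v * (d v)⁻¹) :
    Nonempty (K ≃* PresentedGroup (uwRels n)) := by
  have hBK := BR_K hcoc heq
  have hBG := BR_pres n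
  obtain ⟨ψ, hψ⟩ := exists_hom hBK
  have h0 := y00_isY n
  have m0 := mem_UU_self h0
  have hψg : ∀ j a b, ψ (gg (Sg n) (Rg n) j a b) = gg (SK k) (RK k) j a b := by
    intro j a b
    by_cases hj : j + 1 < n
    · unfold gg
      split_ifs
      · exact (hψ j hj).1
      · exact (hψ j hj).2
    · unfold gg
      simp [Sg, Rg, SK, RK, hj, show ¬ j < n - 1 by omega]
  have hψc : ∀ f : Fin n → TT, ψ (costF tkey (gg (Sg n) (Rg n)) f) =
      costF tkey (gg (SK k) (RK k)) f := by
    intro f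
    rw [map_costF]
    congr 1
    funext j a b
    exact hψg j a b
  -- surjectivity
  have hT : ∀ y, IsY y → ∀ π, refi y π →
      hh k y (srt y) π = costF tkey (gg (SK k) (RK k)) (y ∘ π) := by
    intro y hy π hπ
    have hs := srt_refi hy (mem_UU_self hy)
    have := costF_unique hBK hy (fun π => hh k y (srt y) π) (by
      intro π j hj hπ hd
      have h1 := refi_tie hπ (i := ⟨j, by omega⟩) (j := ⟨j + 1, hj⟩) (by simp [Fin.lt_def]) hd
      have hg := refi_good hy hπ (i := ⟨j, by omega⟩) (j := ⟨j + 1, hj⟩) (by simp [Fin.lt_def]) hd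
      have hπ' := refi_swap hπ j hj h1.1
      have e := hh_cocycle hcoc hy hs hπ' hπ
      have e2 := hh_step hcoc heq hy.1 (π * sw j hj) j hj (by
        simpa [Equiv.swap_apply_left, Equiv.swap_apply_right] using hg)
      rw [mul_assoc, Equiv.swap_mul_self, mul_one] at e2
      simp only [Equiv.Perm.mul_apply, Equiv.swap_apply_left, Equiv.swap_apply_right] at e2
      rw [← e, e2]) π hπ
    have e : hh k y (srt y) (srt y) = 1 := by
      have := hh_cocycle hcoc hy hs hs hs
      simpa using this
    rw [this, e, one_mul]
  let b : (Fin n → TT) → K := fun z =>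
    k (y00 n) (pt 1 (z ∘ srt z)) * k (pt (srt z) z) z
  have hbτ : ∀ τ : Equiv.Perm (Fin n), ∀ u, IsY u → b (u ∘ τ) = b u := by
    intro τ u hu
    have e := srt_comp hu τ
    have e1 : (u ∘ τ) ∘ srt (u ∘ τ) = u ∘ srt u := by rw [← e]; rfl
    simp only [b]
    rw [e1, pt_comp (srt (u ∘ τ)) τ u, heq, e]
  have hb1 : ∀ y z, IsY y → z ∈ UU y → b y * k y z * (b z)⁻¹ = ψ (WW (Sg n) (Rg n) y z) := by
    intro y z hy hz
    have hs := mem_UU_self hy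
    have hzY := UU_isY hy hz
    have ry := srt_refi hy hs
    have rz := srt_refi hy hz
    unfold WW
    rw [hψc, ← hT y hy _ rz]
    have e1 := hcoc y _ _ _ hy (pt_mem hs ry) hs hz
    have e2 := hcoc y _ _ _ hy (pt_mem hs ry) hz (pt_mem hz rz)
    have e3 := hcoc y _ _ _ hy (pt_mem hs ry) (pt_mem hs rz) (pt_mem hz rz)
    have m1 : pt 1 (z ∘ srt z) ∈ UU (y00 n) := pt_one_mem (fun i => hz.1 _)
    have m2 : pt 1 (y ∘ srt z) ∈ UU (y00 n) := pt_one_mem (fun i => hy.1 _)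
    rw [k_pt heq y z, ← hcoc _ _ _ _ h0 m2 m0 m1] at e3
    rw [k_inv hcoc hy hz (pt_mem hz rz)] at e2
    simp only [b, hh]
    rw [mul_inv_rev]
    have e4 : k (pt (srt y) y) y * k y z * (k (pt (srt z) z) z)⁻¹ =
        k (pt (srt y) y) (pt (srt z) y) * (k (pt 1 (y ∘ srt z)) (y00 n) *
          k (y00 n) (pt 1 (z ∘ srt z))) := by rw [e1, e2, e3]
    calc _ = k (y00 n) (pt 1 (y ∘ srt y)) * (k (pt (srt y) y) y * k y z *
          (k (pt (srt z) z) z)⁻¹) * (k (y00 n) (pt 1 (z ∘ srt z)))⁻¹ := by group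
      _ = _ := by rw [e4]; group
  have hbH : ∀ t u v, IsY t → u ∈ UU t → v ∈ UU t → b u * k u v * (b v)⁻¹ ∈ ψ.range := by
    intro t u v ht hu hv
    have e1 := hb1 t u ht hu
    have e2 := hb1 t v ht hv
    have ms := mem_UU_self ht
    have e3 := hcoc t _ _ _ ht hu ms hv
    rw [k_inv hcoc ht hu ms] at e3
    refine ⟨(WW (Sg n) (Rg n) t u)⁻¹ * WW (Sg n) (Rg n) t v, ?_⟩
    rw [map_mul, map_inv, ← e1, ← e2, ← e3]
    group
  have hsurj : Function.Surjective ψ := by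
    intro γ
    have h1 := hgen ψ.range b hbτ hbH ((b (y00 n))⁻¹ * γ * b (y00 n))
    have e : b (y00 n) * ((b (y00 n))⁻¹ * γ * b (y00 n)) * (b (y00 n))⁻¹ = γ := by group
    rw [e] at h1
    exact h1
  -- injectivity
  have hC : ∀ z : Fin n → TT, (∀ i, tok (z i)) → WW (Sg n) (Rg n) (y00 n) (pt 1 z) = 1 := by
    intro z hz
    have : (1 : Equiv.Perm (Fin n)) = srt (pt 1 z) := by
      apply srt_unique
      intro i j hij
      simp only [Function.comp, tkey_lt]
      left
      simpa [pt] using hij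
    unfold WW
    rw [← this]
    apply costF_sorted
    intro i j hij
    apply le_of_lt
    rw [tkey_lt]
    left
    simpa [y00] using hij
  have hW0 : WW (Sg n) (Rg n) (y00 n) (y00 n) = 1 := by
    have : y00 n = pt 1 (y00 n) := by
      funext i
      simp [pt, y00]
    conv_lhs => rw [this]
    rw [← this]
    have h2 := hC (y00 n) h0.1
    rwa [← this] at h2
  have hgen1 : ∀ (y : Fin n → TT) (j : ℕ) (hj : j + 1 < n), (∀ i, tok (y i)) →
      good (y ⟨j, by omega⟩) (y ⟨j + 1, hj⟩) →
      Φ (hh k y 1 (sw j hj)) = d (y00 n) *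
        gg (Sg n) (Rg n) j (y ⟨j, by omega⟩) (y ⟨j + 1, hj⟩) * (d (y00 n))⁻¹ := by
    intro y j hj hy hg
    have hj' : j < n := by omega
    let t := wl (mrg j) y
    have htY : IsY t := by
      refine ⟨hy, fun a b hab h => ?_⟩
      have h' : mrg j a = mrg j b := by simpa [t, wl] using h
      have hl : a = b ∨
          (a = ⟨j, hj'⟩ ∧ b = ⟨j + 1, hj⟩) ∨ (a = ⟨j + 1, hj⟩ ∧ b = ⟨j, hj'⟩) := by
        simpa [Fin.ext_iff] using mrg_eq h'
      rcases hl with h | ⟨rfl, rfl⟩ | ⟨rfl, rfl⟩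
      · exact absurd h hab
      · rcases hg.2.2 with h | h
        · exact Or.inl h
        · exact Or.inr (Or.inr (Or.inl h))
      · rcases hg.2.2 with h | h
        · exact Or.inr (Or.inl h)
        · exact Or.inr (Or.inr (Or.inr h))
    have ts := mem_UU_self htY
    have htie : (t ⟨j + 1, hj⟩).1 = (t ⟨j, by omega⟩).1 := by simp [t, wl, mrg_self]
    have r1 : refi t 1 := wl_refi (mrg_mono j) y
    have r2 : refi t (sw j hj) := by
      have := refi_swap r1 j hj htie
      rwa [one_mul] at this
    have hlo : (t ⟨j, by omega⟩).2.1 < (t ⟨j + 1, hj⟩).2.1 := by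
      obtain ⟨g1, g2, g3⟩ := hg
      unfold bes con tok at *
      simp only [t, wl]
      rcases g3 with g3 | g3 <;> linarith
    have hsrt : ∀ i i', i < i' → tkey (t i) < tkey (t i') := by
      intro a b hab
      rw [tkey_lt]
      have hab' : (a : ℕ) < b := hab
      have hle : mrg j a ≤ mrg j b := mrg_mono j hab'.le
      rcases hle.lt_or_eq with h | h
      · left; simpa [t, wl] using h
      · right
        have hl : (a = ⟨j, hj'⟩ ∧ b = ⟨j + 1, hj⟩) := by
          have := mrg_eq h
          simp only [Fin.ext_iff]
          omega
        obtain ⟨rfl, rfl⟩ := hl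
        exact ⟨htie.symm, hlo⟩
    have cost1 : costF tkey (gg (Sg n) (Rg n)) t = 1 := by
      apply costF_sorted
      intro i i' h
      exact (hsrt i i' h).le
    have hm1 : pt 1 y ∈ UU t := pt_mem ts r1
    have hm2 : pt (sw j hj) y ∈ UU t := pt_mem ts r2
    have m1 : pt 1 y ∈ UU (y00 n) := pt_one_mem hy
    have m2 : pt 1 (y ∘ sw j hj) ∈ UU (y00 n) := pt_one_mem (fun i => hy _)
    have hsrtpt : ∀ π : Equiv.Perm (Fin n), π = srt (pt π y) := by
      intro π
      apply srt_unique
      intro a b hab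
      simp only [Function.comp, tkey_lt]
      left
      simpa [pt] using hab
    have w1 : WW (Sg n) (Rg n) t (pt 1 y) = 1 := by
      unfold WW
      rw [← hsrtpt]
      exact cost1
    have w2 : WW (Sg n) (Rg n) t (pt (sw j hj) y) =
        gg (Sg n) (Rg n) j (y ⟨j, by omega⟩) (y ⟨j + 1, hj⟩) := by
      unfold WW
      rw [← hsrtpt]
      have := costF_step hBG htY r2 j hj (by
        rw [Equiv.swap_apply_left, Equiv.swap_apply_right]
        exact hsrt _ _ (by simp [Fin.lt_def]))
      rw [this, Equiv.swap_mul_self, Equiv.swap_apply_left, Equiv.swap_apply_right]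
      have e : t ∘ (1 : Equiv.Perm (Fin n)) = t := rfl
      rw [e, cost1, one_mul]
      rfl
    have dd : d (pt 1 (y ∘ sw j hj)) = d (pt (sw j hj) y) := by
      rw [pt_comp, mul_one]
      exact hd _ _ (UU_isY htY hm2)
    unfold hh
    have e1 : y ∘ (1 : Equiv.Perm (Fin n)) = y := rfl
    rw [map_mul, map_mul, e1, hΦ _ _ _ h0 m0 m1, hΦ _ _ _ htY hm1 hm2, hΦ _ _ _ h0 m2 m0, hW0,
      hC _ hy, hC (y ∘ sw j hj) (fun i => hy _), w1, w2, dd]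
    group
  have hinj : Function.Injective ψ := by
    have hcomp : ∀ g, Φ (ψ g) = d (y00 n) * g * (d (y00 n))⁻¹ := by
      have : Φ.comp ψ = (MulAut.conj (d (y00 n))).toMonoidHom := by
        apply PresentedGroup.ext
        rintro (⟨i, hi⟩ | ⟨i, hi⟩)
        · have hi' : i + 1 < n := by omega
          have e1 : (PresentedGroup.of (Sum.inl ⟨i, hi⟩) : PresentedGroup (uwRels n)) =
            (Rg n i)⁻¹ := by simp [Rg, hi]
          rw [e1, map_inv, map_inv, inv_inj]
          simp only [MonoidHom.comp_apply, MulEquiv.coe_toMonoidHom, MulAut.conj_apply]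
          rw [(hψ i hi').2]
          simp only [RK, hi', dif_pos]
          rw [hgen1]
          · have hnb : ¬ bes (yR n ⟨i, by omega⟩) (yR n ⟨i + 1, hi'⟩) := by
             simp only [bes, yR]
             push Not
             have : ((i : ℕ) : ℝ) < n := by exact_mod_cast (by omega : i < n)
             have : ((i : ℕ) : ℝ) + 1 < n := by exact_mod_cast hi'
             push_cast
             linarith
            simp only [gg, if_neg hnb]
          · intro a
            have : ((a : ℕ) : ℝ) < n := by exact_mod_cast a.2
            simp only [tok, yR]
            linarith
          · have : ((i : ℕ) : ℝ) + 1 < n := by exact_mod_cast hi'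
            refine ⟨?_, ?_, Or.inr ⟨?_, ?_⟩⟩ <;> simp only [tok, yR] <;> push_cast <;> linarith
        · have hi' : i + 1 < n := by omega
          have e1 : (PresentedGroup.of (Sum.inr ⟨i, hi⟩) : PresentedGroup (uwRels n)) =
            Sg n i := by simp [Sg, hi]
          rw [e1]
          simp only [MonoidHom.comp_apply, MulEquiv.coe_toMonoidHom, MulAut.conj_apply]
          rw [(hψ i hi').1]
          simp only [SK, hi', dif_pos]
          rw [hgen1]
          · have hnb : bes (yS n ⟨i, by omega⟩) (yS n ⟨i + 1, hi'⟩) := by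
             simp only [bes, yS]
             push_cast
             linarith
            simp only [gg, if_pos hnb]
          · intro a
            simp [tok, yS]
          · refine ⟨?_, ?_, Or.inl ?_⟩ <;> simp only [tok, bes, yS] <;> push_cast <;> linarith
      intro g
      exact DFunLike.congr_fun this g
    intro g g' h
    have h1 := hcomp g
    rw [h, hcomp g'] at h1
    simpa using h1.symm
  exact ⟨(MulEquiv.ofBijective ψ ⟨hinj, hsurj⟩).symm⟩

end AbsFinal

end

section
open Topology Filter CategoryTheory

noncomputable section TopSide

theorem path_ind {X ι : Type*} [TopologicalSpace X] (N : ι → Set X) (hN : ∀ i, IsOpen (N i))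
    (hcov : ∀ x, ∃ i, x ∈ N i) (P : ∀ a b : X, Path.Homotopic.Quotient a b → Prop)
    (htr : ∀ a b c (γ : Path.Homotopic.Quotient a b) (γ' : Path.Homotopic.Quotient b c),
      P a b γ → P b c γ' → P a c (γ.trans γ'))
    (hloc : ∀ i a b (γ : Path a b), (∀ t, γ t ∈ N i) → P a b (Path.Homotopic.Quotient.mk γ))
    (a b : X) (γ : Path.Homotopic.Quotient a b) : P a b γ := by
  obtain ⟨γ, rfl⟩ := Path.Homotopic.Quotient.mk_surjective γ
  obtain ⟨t, t0, tm, ⟨m, hm⟩, hc⟩ := exists_monotone_Icc_subset_open_cover_unitInterval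
    (c := fun i => γ ⁻¹' (N i)) (fun i => (hN i).preimage γ.continuous) (by
      intro s _
      obtain ⟨i, hi⟩ := hcov (γ s)
      exact Set.mem_iUnion.2 ⟨i, hi⟩)
  have hst : ∀ k, P _ _ (Path.Homotopic.Quotient.mk (γ.subpath (t k) (t (k + 1)))) := by
    intro k
    obtain ⟨i, hi⟩ := hc k
    apply hloc i
    intro s
    have := Path.range_subpath_of_le γ _ _ (tm (Nat.le_succ k))
    have h2 : γ.subpath (t k) (t (k + 1)) s ∈ γ '' Set.Icc (t k) (t (k + 1)) := by
      rw [← this]; exact Set.mem_range_self s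
    obtain ⟨r, hr, hr'⟩ := h2
    rw [← hr']
    exact hi hr
  have hall : ∀ k, P _ _ (Path.Homotopic.Quotient.mk (γ.subpath (t 0) (t (k + 1)))) := by
    intro k
    induction k with
    | zero => exact hst 0
    | succ k ih =>
      have e : Path.Homotopic.Quotient.mk (γ.subpath (t 0) (t (k + 1 + 1))) =
          (Path.Homotopic.Quotient.mk (γ.subpath (t 0) (t (k + 1)))).trans
            (Path.Homotopic.Quotient.mk (γ.subpath (t (k + 1)) (t (k + 1 + 1)))) := by
        rw [← Path.Homotopic.Quotient.mk_trans]
        exact (Path.Homotopic.Quotient.eq.2 ⟨Path.Homotopy.subpathTransSubpath γ _ _ _⟩).symm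
      rw [e]
      exact htr _ _ _ _ _ ih (hst _)
  have h1 := hall m
  rw [t0, hm (m + 1) (by omega), Path.subpath_zero_one] at h1
  have : ∀ a' b' (h : a' = a) (h' : b' = b),
      P a' b' (Path.Homotopic.Quotient.mk (γ.cast h h')) →
      P a b (Path.Homotopic.Quotient.mk γ) := by
    rintro a' b' rfl rfl h
    exact h
  exact this _ _ _ _ h1

theorem UU_open {n : ℕ} (t : Fin n → TT) : IsOpen (UU t) := by
  have : UU t = (⋂ i, {z : Fin n → TT | tok (z i)}) ∩ ⋂ i, ⋂ j,
      ((⋂ (_ : (t i).1 < (t j).1), {z : Fin n → TT | (z i).1 < (z j).1}) ∩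
       ((⋂ (_ : (t i).1 = (t j).1 ∧ bes (t i) (t j)), {z : Fin n → TT | bes (z i) (z j)}) ∩
        (⋂ (_ : (t i).1 = (t j).1 ∧ con (t i) (t j)), {z : Fin n → TT | con (z i) (z j)}))) := by
    ext z
    simp only [UU, Set.mem_ofPred_eq, Set.mem_inter_iff, Set.mem_iInter]
    exact and_congr Iff.rfl (forall_congr' fun i => forall_congr' fun j => by tauto)
  rw [this]
  refine IsOpen.inter (isOpen_iInter_of_finite fun i => ?_) (isOpen_iInter_of_finite fun i =>
    isOpen_iInter_of_finite fun j => (isOpen_iInter_of_finite fun _ => ?_).inter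
      ((isOpen_iInter_of_finite fun _ => ?_).inter (isOpen_iInter_of_finite fun _ => ?_)))
  · exact isOpen_lt (by fun_prop) (by fun_prop)
  · exact isOpen_lt (by fun_prop) (by fun_prop)
  · exact isOpen_lt (by fun_prop) (by fun_prop)
  · exact (isOpen_lt (f := fun z : Fin n → TT => (z i).2.1) (by fun_prop) (by fun_prop)).inter
      (isOpen_lt (f := fun z : Fin n → TT => (z j).2.2) (by fun_prop) (by fun_prop))

theorem cvx_aux {a b p q r s : ℝ} (ha : 0 ≤ a) (hb : 0 ≤ b) (hab : a + b = 1) (h1 : p < q)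
    (h2 : r < s) : a * p + b * r < a * q + b * s := by
  rcases ha.eq_or_lt with h | h
  · subst h
    have : b = 1 := by linarith
    subst this
    linarith
  · have := mul_lt_mul_of_pos_left h1 h
    have := mul_le_mul_of_nonneg_left h2.le hb
    linarith

theorem UU_convex {n : ℕ} (t : Fin n → TT) : Convex ℝ (UU t) := by
  intro u hu v hv a b ha hb hab
  refine ⟨fun i => ?_, fun i j => ⟨fun h => ?_, fun h => ⟨fun h' => ?_, fun h' => ⟨?_, ?_⟩⟩⟩⟩
  · exact cvx_aux ha hb hab (hu.1 i) (hv.1 i)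
  · exact cvx_aux ha hb hab ((hu.2 i j).1 h) ((hv.2 i j).1 h)
  · exact cvx_aux ha hb hab (((hu.2 i j).2 h).1 h') (((hv.2 i j).2 h).1 h')
  · exact cvx_aux ha hb hab (((hu.2 i j).2 h).2 h').1 (((hv.2 i j).2 h).2 h').1
  · exact cvx_aux ha hb hab (((hu.2 i j).2 h).2 h').2 (((hv.2 i j).2 h).2 h').2

theorem perm_inv_aux {n : ℕ} {α : Type*} [LinearOrder α] (g : Fin n → α)
    (τ : Equiv.Perm (Fin n)) (h : ∀ a b, g a < g b → ¬ g (τ b) < g (τ a)) (a : Fin n) :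
    g (τ a) ≤ g a := by
  by_contra hcon
  push Not at hcon
  let L := Finset.univ.filter fun i => g i ≤ g a
  have hb : ∃ b, b ∉ L ∧ τ b ∈ L := by
    by_contra hno
    push Not at hno
    have hsub : L.map τ.symm.toEmbedding ⊆ L := by
      intro c hc
      rw [Finset.mem_map_equiv] at hc
      by_contra hcL
      exact hno c hcL (by simpa using hc)
    have := Finset.eq_of_subset_of_card_le hsub (by simp)
    have haL : a ∈ L := by simp [L]
    rw [← this, Finset.mem_map_equiv] at haL
    simp only [Equiv.symm_symm, L, Finset.mem_filter] at haL
    exact absurd haL.2 (not_le.2 hcon)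
  obtain ⟨b, hb1, hb2⟩ := hb
  simp only [L, Finset.mem_filter, Finset.mem_univ, true_and, not_le] at hb1 hb2
  exact h a b hb1 (lt_of_le_of_lt hb2 hcon)

theorem perm_inv {n : ℕ} {α : Type*} [LinearOrder α] (g : Fin n → α)
    (τ : Equiv.Perm (Fin n)) (h : ∀ a b, g a < g b → ¬ g (τ b) < g (τ a)) (a : Fin n) :
    g (τ a) = g a := by
  apply le_antisymm (perm_inv_aux g τ h a)
  have := perm_inv_aux g τ⁻¹ (fun a b h1 h2 => h _ _ h2 (by simpa using h1)) (τ a)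
  simpa using this

theorem UU_perm {n : ℕ} {y z : Fin n → TT} (hy : IsY y) {τ : Equiv.Perm (Fin n)} (hz : z ∈ UU y)
    (hz' : z ∘ τ ∈ UU y) : τ = 1 := by
  have h1 : ∀ a, (y (τ a)).1 = (y a).1 := by
    apply perm_inv (fun a => (y a).1) τ
    intro a b hab hba
    have e1 := (hz'.2 a b).1 hab
    have e2 := (hz.2 _ _).1 hba
    exact lt_asymm e1 e2
  have hlo : ∀ {w : Fin n → TT}, w ∈ UU y → ∀ a b, (y a).1 = (y b).1 → (y a).2.1 < (y b).2.1 →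
      (w a).2.1 < (w b).2.1 := by
    intro w hw a b hab hl
    have hne : a ≠ b := by rintro rfl; exact lt_irrefl _ hl
    have ta := hy.1 a
    have tb := hy.1 b
    have wa := hw.1 a
    have wb := hw.1 b
    unfold tok at *
    rcases hy.2 a b hne hab with h | h | h | h
    · have := ((hw.2 a b).2 hab).1 h
      unfold bes at this
      linarith
    · unfold bes at h
      linarith
    · exact (((hw.2 a b).2 hab).2 h).1
    · have := h.1
      linarith
  ext a
  congr 1
  by_contra hne
  have h2 : ∀ a, tkey (y (τ a)) = tkey (y a) := by
    apply perm_inv (fun a => tkey (y a)) τ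
    intro a b hab hba
    rw [tkey_lt] at hab hba
    rw [h1, h1] at hba
    rcases hab with h | ⟨h, h'⟩
    · rcases hba with h3 | ⟨h3, h4⟩ <;> linarith
    · rcases hba with h3 | ⟨h3, h4⟩
      · linarith
      · have e1 := hlo hz' a b h h'
        have e2 := hlo hz (τ b) (τ a) (by rw [h1, h1]; exact h3) h4
        exact lt_asymm e1 e2
  exact hne (tkey_inj hy (h2 a))

end TopSide

end

section
open Topology Filter CategoryTheory

noncomputable section TopMain

variable {X : Type*} [TopologicalSpace X]

/-- arrow of a path class -/
def arr {a b : X} (γ : Path.Homotopic.Quotient a b) :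
    FundamentalGroupoid.mk a ⟶ FundamentalGroupoid.mk b := γ

theorem arr_trans {a b c : X} (γ : Path.Homotopic.Quotient a b)
    (γ' : Path.Homotopic.Quotient b c) : arr (γ.trans γ') = arr γ ≫ arr γ' := rfl

/-- loop of a path -/
def lpp {x0 : X} (p : ∀ x, Path.Homotopic.Quotient x0 x) {a b : X}
    (γ : Path.Homotopic.Quotient a b) : FundamentalGroup X x0 :=
  ((p a).trans γ).trans (p b).symm

theorem symm_trans_self {a b : X} (γ : Path.Homotopic.Quotient a b) :
    γ.symm.trans γ = .refl b := by
  have : (Groupoid.inv (arr γ)) ≫ arr γ = 𝟙 _ := Groupoid.inv_comp _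
  exact this

theorem trans_symm_self {a b : X} (γ : Path.Homotopic.Quotient a b) :
    γ.trans γ.symm = .refl a := by
  have : arr γ ≫ (Groupoid.inv (arr γ)) = 𝟙 _ := Groupoid.comp_inv _
  exact this

theorem lpp_trans {x0 : X} (p : ∀ x, Path.Homotopic.Quotient x0 x) {a b c : X}
    (γ : Path.Homotopic.Quotient a b) (γ' : Path.Homotopic.Quotient b c) :
    lpp p (γ.trans γ') = lpp p γ' * lpp p γ := by
  have : arr (p a) ≫ (arr γ ≫ arr γ') ≫ Groupoid.inv (arr (p c)) =
    (arr (p a) ≫ arr γ ≫ Groupoid.inv (arr (p b))) ≫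
      (arr (p b) ≫ arr γ' ≫ Groupoid.inv (arr (p c))) := by simp
  have e1 : lpp p (γ.trans γ') = arr (p a) ≫ (arr γ ≫ arr γ') ≫ Groupoid.inv (arr (p c)) := by
    rw [← Category.assoc]; rfl
  have e2 : lpp p γ' * lpp p γ = (arr (p a) ≫ arr γ ≫ Groupoid.inv (arr (p b))) ≫
      (arr (p b) ≫ arr γ' ≫ Groupoid.inv (arr (p c))) := by
    rw [← Category.assoc (arr (p a)), ← Category.assoc (arr (p b))]; rfl
  rw [e1, e2, this]

theorem lpp_surj {x0 : X} (p : ∀ x, Path.Homotopic.Quotient x0 x) (g : FundamentalGroup X x0) :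
    ∃ γ : Path.Homotopic.Quotient x0 x0, lpp p γ = g := by
  refine ⟨((p x0).symm.trans g).trans (p x0), ?_⟩
  have h : (arr (p x0) ≫ ((Groupoid.inv (arr (p x0))) ≫ arr g) ≫ arr (p x0)) ≫
      Groupoid.inv (arr (p x0)) = arr g := by simp
  exact h

theorem lpp_congr {x0 : X} (p : ∀ x, Path.Homotopic.Quotient x0 x) {a b a' b' : X}
    (γ : Path a b) (γ' : Path a' b') (h : ∀ s, γ s = γ' s) :
    lpp p (.mk γ) = lpp p (.mk γ') := by
  have h0 : a = a' := by rw [← γ.source, ← γ'.source, h]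
  have h1 : b = b' := by rw [← γ.target, ← γ'.target, h]
  subst h0 h1
  have : γ = γ' := by ext s; exact h s
  rw [this]

def segF {n : ℕ} (Q : (Fin n → TT) → X) (u v : Fin n → TT) : unitInterval → X :=
  fun s => Q (AffineMap.lineMap u v (s : ℝ))

open Classical in
def kk {n : ℕ} (Q : (Fin n → TT) → X) {x0 : X} (p : ∀ x, Path.Homotopic.Quotient x0 x)
    (u v : Fin n → TT) : FundamentalGroup X x0 :=
  if h : Continuous (segF Q u v) then
    (lpp p (.mk (⟨⟨segF Q u v, h⟩, rfl, rfl⟩ : Path (segF Q u v 0) (segF Q u v 1))))⁻¹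
  else 1

theorem kk_congr {n : ℕ} (Q : (Fin n → TT) → X) {x0 : X}
    (p : ∀ x, Path.Homotopic.Quotient x0 x) {u v u' v' : Fin n → TT}
    (h : segF Q u v = segF Q u' v') : kk Q p u v = kk Q p u' v' := by
  unfold kk
  by_cases hc : Continuous (segF Q u v)
  · have hc' : Continuous (segF Q u' v') := h ▸ hc
    rw [dif_pos hc, dif_pos hc', inv_inj]
    apply lpp_congr
    intro s
    exact congrFun h s
  · have hc' : ¬ Continuous (segF Q u' v') := h ▸ hc
    rw [dif_neg hc, dif_neg hc']

theorem kk_path {n : ℕ} (Q : (Fin n → TT) → X) {x0 : X}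
    (p : ∀ x, Path.Homotopic.Quotient x0 x) {t u v : Fin n → TT}
    (hQ : ContinuousOn Q (UU t)) (hu : u ∈ UU t) (hv : v ∈ UU t)
    (δ : Path (⟨u, hu⟩ : UU t) ⟨v, hv⟩) :
    kk Q p u v = (lpp p (.mk (δ.map (continuousOn_iff_continuous_domRestrict.1 hQ))))⁻¹ := by
  have hseg : ∀ s : unitInterval, AffineMap.lineMap u v (s : ℝ) ∈ UU t := fun s =>
    (UU_convex t).segment_subset hu hv (by
      rw [segment_eq_image_lineMap]
      exact ⟨s, s.2, rfl⟩)
  have hQ' := continuousOn_iff_continuous_domRestrict.1 hQ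
  let δ0 : Path (⟨u, hu⟩ : UU t) ⟨v, hv⟩ :=
    { toFun := fun s => ⟨AffineMap.lineMap u v (s : ℝ), hseg s⟩
      continuous_toFun := by
        apply Continuous.subtype_mk
        simp only [AffineMap.lineMap_apply_module]
        fun_prop
      source' := by simp
      target' := by simp }
  have hcont : Continuous (segF Q u v) := (δ0.map hQ').continuous
  have : ContractibleSpace (UU t) := (UU_convex t).contractibleSpace ⟨u, hu⟩
  have hh := (SimplyConnectedSpace.paths_homotopic δ δ0).map ⟨_, hQ'⟩
  unfold kk
  rw [dif_pos hcont, inv_inj]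
  have e : Path.Homotopic.Quotient.mk (δ.map hQ') = .mk (δ0.map hQ') :=
    Path.Homotopic.Quotient.eq.2 hh
  rw [e]
  apply lpp_congr
  intro s
  rfl

theorem kk_coc {n : ℕ} (Q : (Fin n → TT) → X) {x0 : X}
    (p : ∀ x, Path.Homotopic.Quotient x0 x) {t u v w : Fin n → TT}
    (hQ : ContinuousOn Q (UU t)) (hu : u ∈ UU t) (hv : v ∈ UU t) (hw : w ∈ UU t) :
    kk Q p u v * kk Q p v w = kk Q p u w := by
  have : ContractibleSpace (UU t) := (UU_convex t).contractibleSpace ⟨u, hu⟩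
  let δ : Path (⟨u, hu⟩ : UU t) ⟨v, hv⟩ := PathConnectedSpace.somePath _ _
  let δ' : Path (⟨v, hv⟩ : UU t) ⟨w, hw⟩ := PathConnectedSpace.somePath _ _
  rw [kk_path Q p hQ hu hv δ, kk_path Q p hQ hv hw δ', kk_path Q p hQ hu hw (δ.trans δ')]
  rw [Path.map_trans, Path.Homotopic.Quotient.mk_trans, lpp_trans, mul_inv_rev]

end TopMain

end

section
open Topology Filter CategoryTheory

noncomputable section TopMain2

variable {X : Type*} [TopologicalSpace X]

theorem join_UU {n : ℕ} {Q : (Fin n → TT) → X} {t u v : Fin n → TT}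
    (hQ : ContinuousOn Q (UU t)) (hu : u ∈ UU t) (hv : v ∈ UU t) : Joined (Q u) (Q v) := by
  have : ContractibleSpace (UU t) := (UU_convex t).contractibleSpace ⟨u, hu⟩
  let δ : Path (⟨u, hu⟩ : UU t) ⟨v, hv⟩ := PathConnectedSpace.somePath _ _
  exact ⟨δ.map (continuousOn_iff_continuous_domRestrict.1 hQ)⟩

open Classical in
def chol {n : ℕ} {G : Type*} [Group G] (S R : ℕ → G) (Q : (Fin n → TT) → X)
    (rep : X → Fin n → TT) (x x' : X) : G :=
  if h : ∃ z ∈ UU (rep x), Q z = x' then WW S R (rep x) h.choose else 1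

theorem top_main {n : ℕ} (Q : (Fin n → TT) → X)
    (hc : ∀ t, IsY t → ContinuousOn Q (UU t))
    (ho : ∀ t, IsY t → ∀ V ⊆ UU t, IsOpen V → IsOpen (Q '' V))
    (hs : ∀ x, ∃ y, IsY y ∧ Q y = x)
    (hτ : ∀ w, ∀ τ : Equiv.Perm (Fin n), Q (w ∘ τ) = Q w)
    (hq : ∀ y y', IsY y → IsY y' → Q y = Q y' → ∃ τ : Equiv.Perm (Fin n), y' = y ∘ τ) (x : X) :
    Nonempty (FundamentalGroup X x ≃* PresentedGroup (uwRels n)) := by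
  have hinjU : ∀ t, IsY t → ∀ u ∈ UU t, ∀ v ∈ UU t, Q u = Q v → u = v := by
    intro t ht u hu v hv h
    obtain ⟨τ, rfl⟩ := hq u v (UU_isY ht hu) (UU_isY ht hv) h
    rw [UU_perm ht hu hv]
    rfl
  have h00 := y00_isY n
  have hjoin : ∀ x, Joined (Q (y00 n)) x := by
    intro x
    obtain ⟨y, hy, rfl⟩ := hs x
    have hm := mem_UU_self hy
    have hr := srt_refi hy hm
    have j1 := join_UU (hc y hy) (pt_mem hm hr) hm
    have j2 := join_UU (hc _ h00) (mem_UU_self h00)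
      (pt_one_mem (z := y ∘ srt y) (fun i => hy.1 _))
    rw [pt_comp, mul_one, hτ] at j2
    exact j2.trans j1
  let x0 : X := Q (y00 n)
  let p : ∀ x, Path.Homotopic.Quotient x0 x := fun x => .mk (hjoin x).somePath
  suffices hK : Nonempty (FundamentalGroup X x0 ≃* PresentedGroup (uwRels n)) by
    obtain ⟨e⟩ := hK
    exact ⟨(FundamentalGroup.fundamentalGroupMulEquivOfPath (hjoin x).somePath).symm.trans e⟩
  choose rep hrY hrQ using hs
  have hrep : ∀ y, IsY y → ∃ τ : Equiv.Perm (Fin n), rep (Q y) = y ∘ τ := fun y hy =>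
    hq y _ hy (hrY _) (hrQ _).symm
  let c := chol (Sg n) (Rg n) Q rep
  have hcv : ∀ x, ∀ z ∈ UU (rep x), c x (Q z) = WW (Sg n) (Rg n) (rep x) z := by
    intro x z hz
    have h : ∃ z' ∈ UU (rep x), Q z' = Q z := ⟨z, hz, rfl⟩
    simp only [c, chol, dif_pos h]
    congr 1
    exact hinjU _ (hrY x) _ h.choose_spec.1 _ hz h.choose_spec.2
  have hcv2 : ∀ t, IsY t → ∀ z ∈ UU t, c (Q t) (Q z) = WW (Sg n) (Rg n) t z := by
    intro t ht z hz
    obtain ⟨τ, hr⟩ := hrep t ht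
    have h1 : z ∘ τ ∈ UU (rep (Q t)) := by rw [hr]; exact UU_comp hz τ
    have h2 := hcv _ _ h1
    rw [hτ, hr, WW_comp (UU_isY ht hz)] at h2
    exact h2
  have hNt : ∀ t, IsY t → ∀ z ∈ UU t, Q z ∈ Q '' UU (rep (Q t)) := by
    intro t ht z hz
    obtain ⟨τ, hr⟩ := hrep t ht
    refine ⟨z ∘ τ, ?_, hτ _ _⟩
    rw [hr]; exact UU_comp hz τ
  obtain ⟨Φ, hΦt, hΦl⟩ := exists_holonomy (fun x => Q '' UU (rep x))
    (fun x => ho _ (hrY x) _ subset_rfl (UU_open _))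
    (fun x => ⟨rep x, mem_UU_self (hrY x), hrQ x⟩) c (by
      rintro x _ ⟨z, hz, rfl⟩
      have hzY := UU_isY (hrY x) hz
      have hopen : IsOpen (Q '' (UU (rep x) ∩ UU z)) :=
        ho _ (hrY x) _ Set.inter_subset_left ((UU_open _).inter (UU_open _))
      filter_upwards [hopen.mem_nhds ⟨z, ⟨hz, mem_UU_self hzY⟩, rfl⟩]
      rintro _ ⟨w, ⟨hw1, hw2⟩, rfl⟩
      rw [hcv _ _ hw1, hcv _ _ hz, hcv2 z hzY w hw2]
      exact WW_cocycle (BR_pres n) (hrY x) hz hw2)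
  have hΦ1 : ∀ a : X, Φ (Path.Homotopic.Quotient.refl a) = 1 := by
    intro a
    have := hΦt (Path.Homotopic.Quotient.refl a) (Path.Homotopic.Quotient.refl a)
    have e : (Path.Homotopic.Quotient.refl a).trans (Path.Homotopic.Quotient.refl a) =
        Path.Homotopic.Quotient.refl a := by
      have : 𝟙 (FundamentalGroupoid.mk a) ≫ 𝟙 (FundamentalGroupoid.mk a) = 𝟙 _ := by simp
      exact this
    rw [e] at this
    simpa using this
  have hΦs : ∀ {a b : X} (γ : Path.Homotopic.Quotient a b), Φ γ.symm = (Φ γ)⁻¹ := by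
    intro a b γ
    rw [eq_inv_iff_mul_eq_one, ← hΦt, symm_trans_self, hΦ1]
  let Ψ : FundamentalGroup X x0 →* PresentedGroup (uwRels n) :=
    { toFun := fun g => (Φ (x := x0) (y := x0) g)⁻¹
      map_one' := by
        rw [FundamentalGroup.one_def, hΦ1, inv_one]
      map_mul' := by
        intro g h
        rw [FundamentalGroup.mul_def, hΦt, mul_inv_rev] }
  have hΨ : ∀ {a b : X} (γ : Path.Homotopic.Quotient a b),
      Ψ (lpp p γ)⁻¹ = Φ (p a) * Φ γ * (Φ (p b))⁻¹ := by
    intro a b γ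
    rw [map_inv]
    change ((Φ (((p a).trans γ).trans (p b).symm))⁻¹)⁻¹ = _
    rw [inv_inv, hΦt, hΦt, hΦs]
  have hsomeP : ∀ t u v : Fin n → TT, IsY t → ∀ (hu : u ∈ UU t) (hv : v ∈ UU t),
      Nonempty (Path (⟨u, hu⟩ : UU t) ⟨v, hv⟩) := by
    intro t u v _ hu hv
    have : ContractibleSpace (UU t) := (UU_convex t).contractibleSpace ⟨u, hu⟩
    exact ⟨PathConnectedSpace.somePath _ _⟩
  refine abs_main (kk Q p) ?_ ?_ ?_ Ψ (fun u => Φ (p (Q u))) ?_ ?_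
  · intro t u v w ht hu hv hw
    exact kk_coc Q p (hc t ht) hu hv hw
  · intro τ u v
    apply kk_congr
    funext s
    unfold segF
    rw [← hτ (AffineMap.lineMap u v (s : ℝ)) τ]
    congr 1
  · intro H b hbτ hbH g
    have hβ : ∀ y, IsY y → b (rep (Q y)) = b y := by
      intro y hy
      obtain ⟨τ, hr⟩ := hrep y hy
      rw [hr, hbτ τ y hy]
    have key := path_ind (fun x => Q '' UU (rep x))
      (fun x => ho _ (hrY x) _ subset_rfl (UU_open _))
      (fun x => ⟨x, rep x, mem_UU_self (hrY x), hrQ x⟩)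
      (fun a a' γ => b (rep a) * (lpp p γ)⁻¹ * (b (rep a'))⁻¹ ∈ H) (by
        intro a1 a2 a3 γ γ' h1 h2
        have := H.mul_mem h1 h2
        rw [lpp_trans, mul_inv_rev]
        convert! this using 1
        group) (by
        intro x a a' γ hγ
        have ht := hrY x
        set t := rep x with ht'
        let e : UU t → X := fun u => Q u
        have he : IsOpenEmbedding e := by
          apply IsOpenEmbedding.of_continuous_injective_isOpenMap
          · exact continuousOn_iff_continuous_domRestrict.1 (hc t ht)
          · rintro ⟨u, hu⟩ ⟨v, hv⟩ h
            exact Subtype.ext (hinjU t ht u hu v hv h)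
          · intro V hV
            have : e '' V = Q '' (Subtype.val '' V) := by
              rw [Set.image_image]
            rw [this]
            apply ho t ht
            · rintro _ ⟨v, _, rfl⟩; exact v.2
            · exact (UU_open t).isOpenMap_subtype_val _ hV
        have hγ' : ∀ s, γ s ∈ Set.range e := by
          intro s
          obtain ⟨z, hz, h⟩ := hγ s
          exact ⟨⟨z, hz⟩, h⟩
        let E := he.isEmbedding.toHomeomorph
        let δ : unitInterval → UU t := fun s => E.symm ⟨γ s, hγ' s⟩
        have hδ : Continuous δ := E.symm.continuous.comp (γ.continuous.subtype_mk _)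
        have hδe : ∀ s, Q (δ s).1 = γ s := by
          intro s
          exact congrArg Subtype.val (E.apply_symm_apply ⟨γ s, hγ' s⟩)
        let δP : Path (⟨(δ 0).1, (δ 0).2⟩ : UU t) ⟨(δ 1).1, (δ 1).2⟩ := ⟨⟨δ, hδ⟩, rfl, rfl⟩
        have h1 := kk_path Q p (hc t ht) (δ 0).2 (δ 1).2 δP
        have h2 : lpp p (.mk γ) = lpp p (.mk (δP.map
            (continuousOn_iff_continuous_domRestrict.1 (hc t ht)))) := by
          apply lpp_congr
          intro s
          exact (hδe s).symm
        have h3 := hbH t _ _ ht (δ 0).2 (δ 1).2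
        rw [h1, ← h2, ← hβ _ (UU_isY ht (δ 0).2), ← hβ _ (UU_isY ht (δ 1).2), hδe, hδe,
          γ.source, γ.target] at h3
        exact h3)
    obtain ⟨γ, hγ⟩ := lpp_surj p g⁻¹
    have := key x0 x0 γ
    rw [hγ, inv_inv, hβ _ h00] at this
    exact this
  · intro τ u hu
    change Φ (p (Q (u ∘ τ))) = Φ (p (Q u))
    rw [hτ]
  · intro t u v ht hu hv
    obtain ⟨δ⟩ := hsomeP t u v ht hu hv
    rw [kk_path Q p (hc t ht) hu hv δ, hΨ]
    have := hΦl (Q t) (δ.map (continuousOn_iff_continuous_domRestrict.1 (hc t ht))) (by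
      intro s
      exact hNt t ht _ (δ s).2)
    rw [this]
    have e1 : c (Q t) ((UU t).domRestrict Q ⟨u, hu⟩) = _ := hcv2 t ht u hu
    have e2 : c (Q t) ((UU t).domRestrict Q ⟨v, hv⟩) = _ := hcv2 t ht v hv
    rw [e1, e2]
    simp only [Set.domRestrict_apply, mul_assoc]

end TopMain2

end

section
open Topology Filter CategoryTheory

noncomputable section WicketSide

theorem e3mk_0 (x y z : ℝ) : e3mk x y z 0 = x := rfl
theorem e3mk_1 (x y z : ℝ) : e3mk x y z 1 = y := rfl
theorem e3mk_2 (x y z : ℝ) : e3mk x y z 2 = z := rfl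

theorem mem_wicket (a b : E2) (x : E3) : x ∈ wicket a b ↔ 0 ≤ x 2 ∧ ∃ t : ℝ,
    x 0 = a 0 + t * (b 0 - a 0) ∧ x 1 = a 1 + t * (b 1 - a 1) ∧
    (x 2) ^ 2 = t * (1 - t) * ((b 0 - a 0) ^ 2 + (b 1 - a 1) ^ 2) := by
  have hd : dist x (e3mk ((a 0 + b 0) / 2) ((a 1 + b 1) / 2) 0) = dist a b / 2 ↔
      (x 0 - (a 0 + b 0) / 2) ^ 2 + (x 1 - (a 1 + b 1) / 2) ^ 2 + (x 2) ^ 2 =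
      ((a 0 - b 0) ^ 2 + (a 1 - b 1) ^ 2) / 4 := by
    rw [← sq_eq_sq₀ dist_nonneg (by positivity), div_pow, EuclideanSpace.dist_sq_eq,
      EuclideanSpace.dist_sq_eq]
    simp only [Fin.sum_univ_three, Fin.sum_univ_two, Real.dist_eq, sq_abs, e3mk_0, e3mk_1, e3mk_2]
    norm_num
  unfold wicket
  simp only [Set.mem_ofPred_eq]
  rw [hd]
  constructor
  · rintro ⟨h0, h1, t, h2, h3⟩
    refine ⟨h0, t, h2, h3, ?_⟩
    rw [h2, h3] at h1
    linear_combination h1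
  · rintro ⟨h0, t, h2, h3, h1⟩
    refine ⟨h0, ?_, t, h2, h3⟩
    rw [h2, h3]
    linear_combination h1

theorem wicket_comm (a b : E2) : wicket a b = wicket b a := by
  have : ∀ a b : E2, wicket a b ⊆ wicket b a := by
    intro a b x hx
    rw [mem_wicket] at hx ⊢
    obtain ⟨h0, t, h1, h2, h3⟩ := hx
    refine ⟨h0, 1 - t, ?_, ?_, ?_⟩
    · rw [h1]; ring
    · rw [h2]; ring
    · rw [h3]; ring
  exact (this a b).antisymm (this b a)

theorem left_mem (a b : E2) : e3mk (a 0) (a 1) 0 ∈ wicket a b := by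
  rw [mem_wicket, e3mk_0, e3mk_1, e3mk_2]
  exact ⟨le_refl _, 0, by ring, by ring, by ring⟩

theorem E2_ext {a b : E2} (h0 : a 0 = b 0) (h1 : a 1 = b 1) : a = b := by
  ext i
  fin_cases i
  · exact h0
  · exact h1

theorem left_eq {a b a' b' : E2} (h : a' ≠ b') (hw : wicket a b = wicket a' b') :
    a = a' ∨ a = b' := by
  have h1 := left_mem a b
  rw [hw, mem_wicket, e3mk_0, e3mk_1, e3mk_2] at h1
  obtain ⟨-, t, h1, h2, h3⟩ := h1
  have hD : (b' 0 - a' 0) ^ 2 + (b' 1 - a' 1) ^ 2 ≠ 0 := by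
    intro h0
    apply h
    apply E2_ext <;> nlinarith [sq_nonneg (b' 0 - a' 0), sq_nonneg (b' 1 - a' 1)]
  have h4 : t * (1 - t) = 0 := by
    have : t * (1 - t) * ((b' 0 - a' 0) ^ 2 + (b' 1 - a' 1) ^ 2) = 0 := by rw [← h3]; ring
    exact (mul_eq_zero.1 this).resolve_right hD
  rcases mul_eq_zero.1 h4 with h5 | h5
  · left
    subst h5
    exact E2_ext (by rw [h1]; ring) (by rw [h2]; ring)
  · right
    have : t = 1 := by linarith
    subst this
    exact E2_ext (by rw [h1]; ring) (by rw [h2]; ring)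

theorem pair_eq {a b a' b' : E2} (h : a ≠ b) (h' : a' ≠ b') (hw : wicket a b = wicket a' b') :
    (a = a' ∧ b = b') ∨ (a = b' ∧ b = a') := by
  have h1 := left_eq h' hw
  have h2 := left_eq (a := b) (b := a) h' (by rw [wicket_comm, hw])
  rcases h1 with rfl | rfl <;> rcases h2 with rfl | rfl
  · exact absurd rfl h
  · exact Or.inl ⟨rfl, rfl⟩
  · exact Or.inr ⟨rfl, rfl⟩
  · exact absurd rfl h

/-- normalized data of an endpoint pair -/
def rr (f : E2 × E2) : TT := ((f.1 0 + f.2 0) / 2, min (f.1 1) (f.2 1), max (f.1 1) (f.2 1))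

theorem rr_eq {f g : E2 × E2} (hf : f.1 ≠ f.2) (hg : g.1 ≠ g.2)
    (hw : wicket f.1 f.2 = wicket g.1 g.2) : rr f = rr g := by
  rcases pair_eq hf hg hw with ⟨h1, h2⟩ | ⟨h1, h2⟩
  · simp only [rr, h1, h2]
  · simp only [rr, h1, h2, min_comm (g.2 1), max_comm (g.2 1), add_comm (g.2 0)]

def vp (a : TT) : E2 × E2 := (!₂[a.1, a.2.1], !₂[a.1, a.2.2])

theorem rr_vp {a : TT} (h : tok a) : rr (vp a) = a := by
  unfold tok at h
  simp [rr, vp, min_eq_left h.le, max_eq_right h.le]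

theorem vp_rr {f : E2 × E2} (h : f.1 0 = f.2 0) : vp (rr f) = f ∨ vp (rr f) = (f.2, f.1) := by
  rcases le_total (f.1 1) (f.2 1) with h1 | h1
  · left
    refine Prod.ext (E2_ext ?_ ?_) (E2_ext ?_ ?_) <;> simp [vp, rr, h, h1]
  · right
    refine Prod.ext (E2_ext ?_ ?_) (E2_ext ?_ ?_) <;> simp [vp, rr, h, h1]

theorem tok_rr {f : E2 × E2} (hf : f.1 ≠ f.2) (h : f.1 0 = f.2 0) : tok (rr f) := by
  unfold tok rr
  simp only [min_lt_max]
  intro h1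
  exact hf (E2_ext h h1)

theorem wicket_vp_rr {f : E2 × E2} (h : f.1 0 = f.2 0) :
    wicket (vp (rr f)).1 (vp (rr f)).2 = wicket f.1 f.2 := by
  rcases vp_rr h with h | h
  · rw [h]
  · rw [h, wicket_comm]

theorem vp_ne {a : TT} (h : tok a) : (vp a).1 ≠ (vp a).2 := by
  intro h1
  have := congrArg (fun v : E2 => v 1) h1
  simp [vp] at this
  exact (ne_of_lt h) this

theorem mem_vp {a : TT} (h : tok a) (x : E3) : x ∈ wicket (vp a).1 (vp a).2 ↔
    0 ≤ x 2 ∧ x 0 = a.1 ∧ (x 2) ^ 2 = (x 1 - a.2.1) * (a.2.2 - x 1) := by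
  have h' : a.2.2 - a.2.1 ≠ 0 := by
    unfold tok at h
    exact (sub_pos.2 h).ne'
  rw [mem_wicket]
  simp only [vp]
  constructor
  · rintro ⟨h0, t, h1, h2, h3⟩
    simp at h1 h2 h3
    refine ⟨h0, h1, ?_⟩
    rw [h2, h3]; ring
  · rintro ⟨h0, h1, h2⟩
    refine ⟨h0, (x 1 - a.2.1) / (a.2.2 - a.2.1), ?_, ?_, ?_⟩
    · simp [h1]
    · simp; field_simp; ring
    · simp; rw [h2]; field_simp; ring

theorem vp_bds {a : TT} (h : tok a) {x : E3} (hx : x ∈ wicket (vp a).1 (vp a).2) :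
    a.2.1 ≤ x 1 ∧ x 1 ≤ a.2.2 := by
  rw [mem_vp h] at hx
  obtain ⟨h0, h1, h2⟩ := hx
  unfold tok at h
  have h3 : 0 ≤ (x 1 - a.2.1) * (a.2.2 - x 1) := by rw [← h2]; positivity
  constructor <;> nlinarith

theorem disj_of_con {a b : TT} (ha : tok a) (hb : tok b) (h : con a b) :
    Disjoint (wicket (vp a).1 (vp a).2) (wicket (vp b).1 (vp b).2) := by
  rw [Set.disjoint_left]
  intro x hxa hxb
  obtain ⟨h1, h2⟩ := vp_bds hb hxb
  rw [mem_vp ha] at hxa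
  rw [mem_vp hb] at hxb
  have e := hxa.2.2.symm.trans hxb.2.2
  unfold con at h
  nlinarith [mul_nonneg (sub_nonneg.2 h1) (sub_nonneg.2 h2), mul_pos (sub_pos.2 h.1) (sub_pos.2 h.2),
    mul_nonneg (sub_nonneg.2 h1) (sub_pos.2 h.2).le,
    mul_nonneg (sub_nonneg.2 h2) (sub_pos.2 h.1).le]

theorem disj_of_bes {a b : TT} (ha : tok a) (hb : tok b) (h : bes a b) :
    Disjoint (wicket (vp a).1 (vp a).2) (wicket (vp b).1 (vp b).2) := by
  rw [Set.disjoint_left]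
  intro x hxa hxb
  have h1 := vp_bds hb hxb
  have h2 := vp_bds ha hxa
  unfold bes at h
  linarith [h1.1, h2.2]

theorem disj_vp {a b : TT} (ha : tok a) (hb : tok b) (h : a.1 = b.1 → unl a b) :
    Disjoint (wicket (vp a).1 (vp a).2) (wicket (vp b).1 (vp b).2) := by
  by_cases h1 : a.1 = b.1
  · rcases h h1 with h | h | h | h
    · exact disj_of_bes ha hb h
    · exact (disj_of_bes hb ha h).symm
    · exact disj_of_con ha hb h
    · exact (disj_of_con hb ha h).symm
  · rw [Set.disjoint_left]
    intro x hxa hxb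
    rw [mem_vp ha] at hxa
    rw [mem_vp hb] at hxb
    exact h1 (hxa.2.1.symm.trans hxb.2.1)

theorem unl_aux {a b : TT} (ha : tok a) (hb : tok b) (h1 : a.1 = b.1)
    (hd : Disjoint (wicket (vp a).1 (vp a).2) (wicket (vp b).1 (vp b).2))
    (hle : a.2.1 ≤ b.2.1) : unl a b := by
  by_contra hu
  have hn1 : ¬ bes a b := fun h => hu (Or.inl h)
  have hn3 : ¬ con a b := fun h => hu (Or.inr (Or.inr (Or.inl h)))
  unfold bes at hn1
  unfold con at hn3
  push Not at hn1 hn3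
  rw [Set.disjoint_left] at hd
  rcases hle.eq_or_lt with h | h
  · apply hd (a := e3mk a.1 a.2.1 0)
    · rw [mem_vp ha, e3mk_0, e3mk_1, e3mk_2]
      exact ⟨le_refl _, rfl, by ring⟩
    · rw [mem_vp hb, e3mk_0, e3mk_1, e3mk_2]
      exact ⟨le_refl _, h1, by rw [h]; ring⟩
  · have h2 := hn3 h
    have hD : 0 < (b.2.1 + b.2.2) - (a.2.1 + a.2.2) := by linarith
    set D := (b.2.1 + b.2.2) - (a.2.1 + a.2.2) with hDd
    set X := (b.2.1 * b.2.2 - a.2.1 * a.2.2) / D with hX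
    have hXD : X * D = b.2.1 * b.2.2 - a.2.1 * a.2.2 := by rw [hX]; field_simp
    have e1 : (X - b.2.1) * D = (b.2.1 - a.2.1) * (a.2.2 - b.2.1) := by
      rw [sub_mul, hXD, hDd]; ring
    have e2 : (a.2.2 - X) * D = (a.2.2 - b.2.1) * (b.2.2 - a.2.2) := by
      rw [sub_mul, hXD, hDd]; ring
    have p1 : 0 ≤ X - b.2.1 := by
      have : 0 ≤ (X - b.2.1) * D := by
        rw [e1]; exact mul_nonneg (by linarith) (by linarith)
      exact nonneg_of_mul_nonneg_left this hD
    have p2 : 0 ≤ a.2.2 - X := by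
      have : 0 ≤ (a.2.2 - X) * D := by
        rw [e2]; exact mul_nonneg (by linarith) (by linarith)
      exact nonneg_of_mul_nonneg_left this hD
    have p3 : 0 ≤ (X - a.2.1) * (a.2.2 - X) := mul_nonneg (by linarith) p2
    have e3 : (X - a.2.1) * (a.2.2 - X) = (X - b.2.1) * (b.2.2 - X) := by
      rw [hDd] at hXD
      linarith
    apply hd (a := e3mk a.1 X (Real.sqrt ((X - a.2.1) * (a.2.2 - X))))
    · rw [mem_vp ha, e3mk_0, e3mk_1, e3mk_2]
      exact ⟨Real.sqrt_nonneg _, rfl, Real.sq_sqrt p3⟩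
    · rw [mem_vp hb, e3mk_0, e3mk_1, e3mk_2]
      exact ⟨Real.sqrt_nonneg _, h1, by rw [Real.sq_sqrt p3, e3]⟩

theorem unl_of_disj {a b : TT} (ha : tok a) (hb : tok b) (h1 : a.1 = b.1)
    (hd : Disjoint (wicket (vp a).1 (vp a).2) (wicket (vp b).1 (vp b).2)) : unl a b := by
  rcases le_total a.2.1 b.2.1 with h | h
  · exact unl_aux ha hb h1 hd h
  · have := unl_aux hb ha h1.symm hd.symm h
    unfold unl at *
    tauto

theorem vt_ok {n : ℕ} {y : Fin n → TT} (hy : IsY y) : IsWicketTuple (fun i => vp (y i)) :=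
  ⟨fun i => vp_ne (hy.1 i), fun i j hij => disj_vp (hy.1 i) (hy.1 j) (hy.2 i j hij)⟩

def rt {n : ℕ} (f : WicketTuple n) : Fin n → TT := fun i => rr (f.1 i)

theorem rt_cont {n : ℕ} : Continuous (rt (n := n)) := by
  have h : ∀ j : Fin 2, Continuous fun v : E2 => v j := fun j => by fun_prop
  have hr : Continuous rr := by
    have a1 := fun j => (h j).comp (continuous_fst (X := E2) (Y := E2))
    have a2 := fun j => (h j).comp (continuous_snd (X := E2) (Y := E2))
    exact (((a1 0).add (a2 0)).div_const 2).prodMk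
      (((a1 1).min (a2 1)).prodMk ((a1 1).max (a2 1)))
  exact continuous_pi fun i => hr.comp ((continuous_apply i).comp continuous_subtype_val)

theorem rt_isY {n : ℕ} {f : WicketTuple n} (hf : IsUWTuple f) : IsY (rt f) := by
  refine ⟨fun i => tok_rr (f.2.1 i) (hf i), fun i j hij h => ?_⟩
  apply unl_of_disj (tok_rr (f.2.1 i) (hf i)) (tok_rr (f.2.1 j) (hf j)) h
  simp only [wicket_vp_rr (hf i), wicket_vp_rr (hf j)]
  exact f.2.2 i j hij

def vt {n : ℕ} {y : Fin n → TT} (hy : IsY y) : WicketTuple n := ⟨fun i => vp (y i), vt_ok hy⟩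

theorem rt_vt {n : ℕ} {y : Fin n → TT} (hy : IsY y) : rt (vt hy) = y := by
  funext i
  exact rr_vp (hy.1 i)

theorem vt_rt {n : ℕ} {f : WicketTuple n} (hf : IsUWTuple f) :
    (Quotient.mk (wicketSetoid n) (vt (rt_isY hf))) = Quotient.mk (wicketSetoid n) f := by
  apply Quotient.sound
  change Set.range _ = Set.range _
  congr 1
  funext i
  exact wicket_vp_rr (hf i)

theorem wk_inj {n : ℕ} (f : WicketTuple n) :
    Function.Injective fun i => wicket (f.1 i).1 (f.1 i).2 := by
  intro i j h
  by_contra hij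
  have h1 := f.2.2 i j hij
  have h2 := left_mem (f.1 i).1 (f.1 i).2
  simp only at h
  exact Set.disjoint_left.1 h1 h2 (h ▸ h2)

theorem rt_perm {n : ℕ} {f g : WicketTuple n}
    (h : Quotient.mk (wicketSetoid n) f = Quotient.mk (wicketSetoid n) g) :
    ∃ τ : Equiv.Perm (Fin n), rt g = rt f ∘ τ := by
  have h' : (Set.range fun i => wicket (f.1 i).1 (f.1 i).2) =
    Set.range fun i => wicket (g.1 i).1 (g.1 i).2 := Quotient.exact h
  have h1 : ∀ i, ∃ j, wicket (f.1 j).1 (f.1 j).2 = wicket (g.1 i).1 (g.1 i).2 := by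
    intro i
    have : wicket (g.1 i).1 (g.1 i).2 ∈ Set.range fun i => wicket (f.1 i).1 (f.1 i).2 := by
      rw [h']; exact ⟨i, rfl⟩
    exact this
  choose τ hτ using h1
  have hinj : Function.Injective τ := by
    intro i j hij
    apply wk_inj g
    simp only
    rw [← hτ, ← hτ, hij]
  refine ⟨Equiv.ofBijective τ (Finite.injective_iff_bijective.1 hinj), ?_⟩
  funext i
  exact (rr_eq (f.2.1 _) (g.2.1 _) (hτ i)).symm

theorem perm_mk {n : ℕ} {f g : WicketTuple n} (τ : Equiv.Perm (Fin n)) (h : g.1 = f.1 ∘ τ) :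
    Quotient.mk (wicketSetoid n) g = Quotient.mk (wicketSetoid n) f := by
  apply Quotient.sound
  change Set.range _ = Set.range _
  rw [h]
  exact τ.surjective.range_comp (fun i => wicket (f.1 i).1 (f.1 i).2)

open Classical in
def QQ {n : ℕ} (x : UWConf n) (y : Fin n → TT) : UWConf n :=
  if h : IsY y then ⟨Quotient.mk _ (vt h), vt h, rfl, fun _ => rfl⟩ else x

theorem final_main (n : ℕ) (x : UWConf n) :
    Nonempty (FundamentalGroup (UWConf n) x ≃* PresentedGroup (uwRels n)) := by
  have hQ : ∀ {y} (h : IsY y), (QQ x y).1 = Quotient.mk _ (vt h) := by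
    intro y h
    unfold QQ
    rw [dif_pos h]
  have hs : ∀ x', ∀ f : WicketTuple n, IsUWTuple f → Quotient.mk _ f = x'.1 →
      QQ x (rt f) = x' := by
    intro x' f hf h
    apply Subtype.ext
    rw [hQ (rt_isY hf), vt_rt hf, h]
  have hτ : ∀ w, ∀ τ : Equiv.Perm (Fin n), QQ x (w ∘ τ) = QQ x w := by
    intro w τ
    by_cases hw : IsY w
    · apply Subtype.ext
      rw [hQ hw, hQ (hw.comp τ)]
      exact perm_mk τ rfl
    · have hw' : ¬ IsY (w ∘ τ) := by
        intro h
        apply hw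
        have := h.comp τ⁻¹
        have e : (w ∘ τ) ∘ (τ⁻¹ : Equiv.Perm (Fin n)) = w := by
          funext i; simp
        rwa [e] at this
      unfold QQ
      rw [dif_neg hw, dif_neg hw']
  refine top_main (QQ x) ?_ ?_ ?_ hτ ?_ x
  · intro t ht
    rw [continuousOn_iff_continuous_domRestrict]
    have : Set.domRestrict (UU t) (QQ x) = fun u : UU t =>
        (⟨Quotient.mk _ (vt (UU_isY ht u.2)), vt (UU_isY ht u.2), rfl, fun i => rfl⟩ : UWConf n) := by
      funext u
      apply Subtype.ext
      exact hQ (UU_isY ht u.2)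
    rw [this]
    apply Continuous.subtype_mk
    apply continuous_quotient_mk'.comp
    apply Continuous.subtype_mk
    have h2 : Continuous fun a : ℝ × ℝ => (!₂[a.1, a.2] : E2) := by
      refine (PiLp.continuous_toLp 2 _).comp (continuous_pi fun i => ?_)
      fin_cases i
      · exact continuous_fst
      · exact continuous_snd
    have hv : Continuous vp := by
      have a1 : Continuous fun a : TT => (a.1, a.2.1) := by fun_prop
      have a2 : Continuous fun a : TT => (a.1, a.2.2) := by fun_prop
      exact (h2.comp a1).prodMk (h2.comp a2)
    exact continuous_pi fun i => hv.comp ((continuous_apply i).comp continuous_subtype_val)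
  · intro t ht V hV hVo
    let O : Set (WConf n) := {c | ∃ f, Quotient.mk _ f = c ∧ rt f ∈ V}
    have hO : IsOpen O := by
      suffices hO' : IsOpen (Quotient.mk (wicketSetoid n) ⁻¹' O) from hO'
      have : Quotient.mk (wicketSetoid n) ⁻¹' O =
          ⋃ τ : Equiv.Perm (Fin n), (fun f : WicketTuple n => rt f ∘ τ) ⁻¹' V := by
        ext f
        simp only [Set.mem_preimage, Set.mem_iUnion]
        constructor
        · rintro ⟨g, hg, hgV⟩
          obtain ⟨τ, hτ'⟩ := rt_perm hg.symm
          exact ⟨τ, hτ' ▸ hgV⟩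
        · rintro ⟨τ, h⟩
          let g : WicketTuple n := ⟨f.1 ∘ τ, fun i => f.2.1 _, fun i j hij =>
            f.2.2 _ _ (fun h => hij (τ.injective h))⟩
          exact ⟨g, perm_mk τ rfl, h⟩
      rw [this]
      refine isOpen_iUnion fun τ => hVo.preimage ?_
      have := rt_cont (n := n)
      fun_prop
    have : QQ x '' V = Subtype.val ⁻¹' O := by
      ext x'
      constructor
      · rintro ⟨y, hy, rfl⟩
        have hyY := UU_isY ht (hV hy)
        refine ⟨vt hyY, (hQ hyY).symm, ?_⟩
        rw [rt_vt]; exact hy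
      · rintro ⟨f, hf, hfV⟩
        obtain ⟨g, hg, hgU⟩ := x'.2
        obtain ⟨τ, hτ'⟩ := rt_perm (hg.trans hf.symm)
        refine ⟨rt f, hfV, ?_⟩
        rw [hτ', hτ]
        exact hs x' g hgU hg
    rw [this]
    exact hO.preimage continuous_subtype_val
  · intro x'
    obtain ⟨g, hg, hgU⟩ := x'.2
    exact ⟨rt g, rt_isY hgU, hs x' g hgU hg⟩
  · intro y y' hy hy' h
    have h1 := congrArg Subtype.val h
    rw [hQ hy, hQ hy'] at h1
    obtain ⟨τ, hτ'⟩ := rt_perm h1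
    rw [rt_vt, rt_vt] at hτ'
    exact ⟨τ, hτ'⟩

end WicketSide

end

/-- The fundamental group of the untwisted wicket space `𝒰𝒲_n` is isomorphic to the
group presented by the generators `ρ_i`, `σ_i` with the braid and braid-like relations. -/
theorem statement10 (n : ℕ) (x : ↥(UWConf n)) :
    Nonempty (FundamentalGroup (↥(UWConf n)) x ≃* PresentedGroup (uwRels n)) := by
  exact final_main n x
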